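/- Let 𝔸₁ denote the set of positive integers all of whose prime divisors are congruent to 1 modulo 4, and ω(n) the number of distinct prime divisors of n. Fix constants 0 < a < b and β > 0. Then there exist positive constants C₁, C₂ and Λ₀ such that for all real Λ ≥ Λ₀, with K = ⌊β log log Λ⌋, the set S_{Λ,K} := { ℓ ∈ ℕ : aΛ² ≤ ℓ ≤ bΛ², ℓ ∈ 𝔸₁, ω(ℓ) = K } satisfies C₁ · (Λ²/√(log log Λ)) · (log Λ)^{β − 1 − β log(2β)} ≤ |S_{Λ,K}| ≤ C₂ · (Λ²/√(log log Λ)) · (log Λ)^{β − 1 − β log(2β)}. -/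

import Mathlib

open Real

/-- The set of positive integers all of whose prime divisors are ≡ 1 (mod 4). -/
def A1 : Set ℕ := {n : ℕ | 0 < n ∧ ∀ p : ℕ, p.Prime → p ∣ n → p % 4 = 1}

/-- One half of the Fourier transform of the tent function on `[-T, T]`. -/
noncomputable def fejer (T x : ℝ) : ℝ := ∫ t in (0 : ℝ)..T, (1 - t / T) * cos (t * x)

lemma fejer_eq {T x : ℝ} (hT : 0 < T) (hx : x ≠ 0) :
    fejer T x = (1 - cos (T * x)) / (T * x ^ 2) := by
  have h : ∀ t ∈ Set.uIcc (0 : ℝ) T, HasDerivAt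
      (fun t => (1 - t / T) * sin (t * x) / x - cos (t * x) / (T * x ^ 2))
      ((1 - t / T) * cos (t * x)) t := by
    intro t _
    have h1 : HasDerivAt (fun t : ℝ => t * x) x t := by
      simpa using (hasDerivAt_id t).mul_const x
    have h2 : HasDerivAt (fun t : ℝ => 1 - t / T) (-(1 / T)) t := by
      simpa using ((hasDerivAt_id t).div_const T).const_sub 1
    have := ((h2.mul h1.sin).div_const x).sub (h1.cos.div_const (T * x ^ 2))
    convert! this using 1
    field_simp
    ring
  unfold fejer
  rw [intervalIntegral.integral_eq_sub_of_hasDerivAt h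
    (Continuous.intervalIntegrable (by fun_prop) _ _)]
  field_simp
  simp
  ring

lemma fejer_nonneg {T : ℝ} (hT : 0 < T) (x : ℝ) : 0 ≤ fejer T x := by
  rcases eq_or_ne x 0 with rfl | hx
  · unfold fejer
    refine intervalIntegral.integral_nonneg hT.le fun t ht => ?_
    have : t / T ≤ 1 := by rw [div_le_one hT]; exact ht.2
    simp
    linarith
  · rw [fejer_eq hT hx]
    have := cos_le_one (T * x)
    have : 0 ≤ 1 - cos (T * x) := by linarith
    positivity

lemma integral_tent {T : ℝ} (hT : 0 < T) : ∫ t in (0 : ℝ)..T, (1 - t / T) = T / 2 := by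
  rw [intervalIntegral.integral_sub (by simp)
    (Continuous.intervalIntegrable (by fun_prop) _ _)]
  simp
  field_simp
  ring

lemma fejer_le {T : ℝ} (hT : 0 < T) (x : ℝ) : fejer T x ≤ T := by
  have : fejer T x ≤ T / 2 := by
    rw [← integral_tent hT]
    unfold fejer
    refine intervalIntegral.integral_mono_on hT.le
      (Continuous.intervalIntegrable (by fun_prop) _ _)
      (Continuous.intervalIntegrable (by fun_prop) _ _) fun t ht => ?_
    have h1 : t / T ≤ 1 := by rw [div_le_one hT]; exact ht.2
    nlinarith [cos_le_one (t * x)]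
  linarith

lemma fejer_le_div {T x : ℝ} (hT : 0 < T) (hx : x ≠ 0) : fejer T x ≤ 2 / (T * x ^ 2) := by
  rw [fejer_eq hT hx]
  have := neg_one_le_cos (T * x)
  have hx2 : 0 < x ^ 2 := by positivity
  gcongr
  linarith

lemma le_fejer {T x : ℝ} (hT : 0 < T) (hx : |T * x| ≤ 1) : T / 4 ≤ fejer T x := by
  have h : T / 4 = ∫ t in (0 : ℝ)..T, (1 - t / T) * (1 / 2) := by
    rw [intervalIntegral.integral_mul_const, integral_tent hT]; ring
  rw [h]
  unfold fejer
  refine intervalIntegral.integral_mono_on hT.le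
    (Continuous.intervalIntegrable (by fun_prop) _ _)
    (Continuous.intervalIntegrable (by fun_prop) _ _) fun t ht => ?_
  have h1 : t / T ≤ 1 := by rw [div_le_one hT]; exact ht.2
  have h2 : |t * x| ≤ 1 := by
    refine le_trans ?_ hx
    rw [abs_mul, abs_mul, abs_of_nonneg ht.1, abs_of_pos hT]
    gcongr
    exact ht.2
  have h3 : (1 : ℝ) / 2 ≤ cos (t * x) := by
    have := one_sub_sq_div_two_le_cos (x := t * x)
    have h4 : (t * x) ^ 2 ≤ 1 := by rw [← sq_abs]; nlinarith [abs_nonneg (t * x)]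
    linarith
  exact mul_le_mul_of_nonneg_left h3 (by linarith)

lemma re_exp_mul_term (c : ℕ → ℝ) {σ : ℝ} (hσ : 0 < σ) (t u : ℝ) (n : ℕ) :
    (Complex.exp (t * u * Complex.I) *
      LSeries.term (fun n => (c n : ℂ)) (σ + t * Complex.I) n).re =
      c n / (n : ℝ) ^ σ * cos (t * (u - log n)) := by
  rcases eq_or_ne n 0 with rfl | hn
  · simp [Real.zero_rpow hσ.ne']
  · have hn' : (0 : ℝ) < n := by positivity
    rw [LSeries.term_of_ne_zero hn, Complex.cpow_add _ _ (by exact_mod_cast hn),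
      ← Complex.ofReal_natCast, ← Complex.ofReal_cpow hn'.le,
      Complex.cpow_def_of_ne_zero (by exact_mod_cast hn), ← Complex.ofReal_log hn'.le]
    have : Complex.exp (t * u * Complex.I) * (c n / (((n : ℝ) ^ σ : ℝ) *
        Complex.exp ((log n : ℝ) * (t * Complex.I)))) =
        ((c n / (n : ℝ) ^ σ : ℝ) : ℂ) * Complex.exp ((t * (u - log n) : ℝ) * Complex.I) := by
      have h1 : ((t * (u - log n) : ℝ) : ℂ) * Complex.I =
        t * u * Complex.I - (log n : ℝ) * (t * Complex.I) := by push_cast; ring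
      rw [h1, Complex.exp_sub]
      push_cast
      field_simp
    rw [this, Complex.re_ofReal_mul, Complex.exp_ofReal_mul_I_re]

lemma hasSum_mul_fejer (c : ℕ → ℝ) {σ T : ℝ} (hσ : 0 < σ) (hT : 0 < T) (u : ℝ)
    (hc : Summable fun n => |c n| / (n : ℝ) ^ σ) :
    HasSum (fun n : ℕ => c n / (n : ℝ) ^ σ * fejer T (u - log n))
      (∫ t in (0 : ℝ)..T, (1 - t / T) * (Complex.exp (t * u * Complex.I) *
        LSeries (fun n => (c n : ℂ)) (σ + t * Complex.I)).re) := by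
  have hb : ∀ (n : ℕ) (t : ℝ), t ∈ Set.uIoc 0 T →
      ‖(1 - t / T) * (c n / (n : ℝ) ^ σ * cos (t * (u - log n)))‖ ≤ |c n| / (n : ℝ) ^ σ := by
    intro n t ht
    rw [Set.uIoc_of_le hT.le] at ht
    have h1 : t / T ≤ 1 := by rw [div_le_one hT]; exact ht.2
    have h0 : 0 ≤ t / T := div_nonneg ht.1.le hT.le
    have h2 : |1 - t / T| ≤ 1 := by rw [abs_le]; constructor <;> linarith
    have h3 := abs_cos_le_one (t * (u - log n))
    have h4 : 0 ≤ |c n| / (n : ℝ) ^ σ := by positivity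
    rw [Real.norm_eq_abs, abs_mul, abs_mul, abs_div, abs_of_nonneg (rpow_nonneg n.cast_nonneg σ)]
    calc _ ≤ 1 * (|c n| / (n : ℝ) ^ σ * 1) := by gcongr
      _ = _ := by ring
  have hsum (t : ℝ) : HasSum (fun n : ℕ => (1 - t / T) * (c n / (n : ℝ) ^ σ *
      cos (t * (u - log n)))) ((1 - t / T) * (Complex.exp (t * u * Complex.I) *
        LSeries (fun n => (c n : ℂ)) (σ + t * Complex.I)).re) := by
    refine HasSum.mul_left _ ?_
    simp_rw [← re_exp_mul_term c hσ]
    have hs : LSeriesSummable (fun n => (c n : ℂ)) (σ + t * Complex.I) := by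
      refine Summable.of_norm_bounded hc fun n => ?_
      rcases eq_or_ne n 0 with rfl | hn
      · simp [Real.zero_rpow hσ.ne']
      · rw [LSeries.norm_term_eq]
        simp [hn]
    exact (Complex.hasSum_re (hs.hasSum.mul_left _))
  have := intervalIntegral.hasSum_integral_of_dominated_convergence (a := 0) (b := T)
    (μ := MeasureTheory.volume)
    (F := fun (n : ℕ) t => (1 - t / T) * (c n / (n : ℝ) ^ σ * cos (t * (u - log n))))
    (fun n _ => |c n| / (n : ℝ) ^ σ)
    (fun n => Continuous.aestronglyMeasurable (by fun_prop))
    (fun n => Filter.Eventually.of_forall (hb n))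
    (Filter.Eventually.of_forall fun _ _ => hc)
    (by simp)
    (Filter.Eventually.of_forall fun t _ => hsum t)
  convert! this using 1
  ext n
  rw [fejer, ← intervalIntegral.integral_const_mul]
  congr 1
  ext t
  ring

lemma tendsto_integral_exp_mul_atTop (T : ℝ) (hT : 0 < T) (g : ℝ → ℂ) :
    Filter.Tendsto (fun u : ℝ => ∫ t in (0 : ℝ)..T, Complex.exp (t * u * Complex.I) * g t)
      Filter.atTop (nhds 0) := by
  have h := Real.tendsto_integral_exp_smul_cocompact ((Set.Ioc 0 T).indicator g)
  have h2 : Filter.Tendsto (fun u : ℝ => -u / (2 * π)) Filter.atTop (Filter.cocompact ℝ) := by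
    rw [cocompact_eq_atBot_atTop]
    refine Filter.Tendsto.mono_right ?_ le_sup_left
    exact (Filter.tendsto_neg_atTop_atBot).atBot_div_const (by positivity)
  refine (h.comp h2).congr fun u => ?_
  simp only [Function.comp]
  rw [intervalIntegral.integral_of_le hT.le, ← MeasureTheory.integral_indicator measurableSet_Ioc]
  congr 1
  ext t
  by_cases ht : t ∈ Set.Ioc 0 T
  · simp only [Set.indicator_of_mem ht]
    rw [Circle.smul_def, Real.fourierChar_apply, smul_eq_mul]
    congr 2
    have : (π : ℂ) ≠ 0 := by exact_mod_cast pi_pos.ne'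
    push_cast
    field_simp
  · simp [Set.indicator_of_notMem ht]

lemma summable_one_div_one_add_int_sq : Summable fun z : ℤ => 1 / (1 + (z : ℝ) ^ 2) := by
  have h : Summable fun z : ℤ => 1 / (z : ℝ) ^ 2 :=
    Real.summable_one_div_int_pow.mpr one_lt_two
  refine Summable.of_norm_bounded_eventually h ?_
  refine Set.Finite.subset (Set.finite_singleton (0 : ℤ)) fun z hz => ?_
  by_contra hz0
  refine hz ?_
  have h0 : (z : ℝ) ≠ 0 := by exact_mod_cast hz0
  have h1 : 0 < (z : ℝ) ^ 2 := by positivity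
  change ‖1 / (1 + (z : ℝ) ^ 2)‖ ≤ _
  rw [Real.norm_of_nonneg (by positivity)]
  gcongr
  linarith

lemma exists_sum_div_one_add_sq_le {f : ℕ → ℝ} (hf : ∀ n, 0 ≤ f n) {B : ℝ}
    (hB : ∀ x : ℝ, 0 ≤ x → ∑ n ∈ Finset.Icc 0 ⌊x⌋₊, f n ≤ B * x) :
    ∃ B₀, 0 ≤ B₀ ∧ ∀ u : ℝ, ∀ s : Finset ℕ,
      ∑ n ∈ s, f n / n * (1 / (1 + (u - log n) ^ 2)) ≤ B₀ := by
  set A := ∑' z : ℤ, 1 / (1 + (z : ℝ) ^ 2) with hA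
  have hA0 : 0 ≤ A := tsum_nonneg fun z => by positivity
  have hB0 : 0 ≤ B := by
    have := hB 1 zero_le_one
    have h2 : 0 ≤ ∑ n ∈ Finset.Icc 0 ⌊(1 : ℝ)⌋₊, f n := Finset.sum_nonneg fun n _ => hf n
    linarith
  refine ⟨3 * (exp 1 * B) * A, by positivity, fun u s => ?_⟩
  have step1 (j : ℕ) : ∑ n ∈ s with ⌊log (n : ℕ)⌋₊ = j, f n / n ≤ exp 1 * B := by
    have h1 : ∀ n ∈ s.filter (fun n : ℕ => ⌊log n⌋₊ = j), f n / n ≤ exp (-j) * f n := by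
      intro n hn
      rcases Nat.eq_zero_or_pos n with rfl | hn0
      · simpa using mul_nonneg (exp_nonneg _) (hf 0)
      have hn' : (0 : ℝ) < n := by positivity
      rw [div_eq_mul_inv, mul_comm]
      refine mul_le_mul_of_nonneg_right ?_ (hf n)
      rw [exp_neg]
      gcongr
      rw [← le_log_iff_exp_le hn']
      rw [← (Finset.mem_filter.mp hn).2]
      exact Nat.floor_le (log_natCast_nonneg n)
    have h2 : s.filter (fun n : ℕ => ⌊log n⌋₊ = j) ⊆ Finset.Icc 0 ⌊exp (j + 1)⌋₊ := by
      intro n hn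
      simp only [Finset.mem_Icc, zero_le, true_and]
      rcases Nat.eq_zero_or_pos n with rfl | hn0
      · simp
      have hn' : (0 : ℝ) < n := by positivity
      refine Nat.le_floor ?_
      rw [← log_le_iff_le_exp hn', ← (Finset.mem_filter.mp hn).2]
      exact (Nat.lt_floor_add_one _).le
    calc _ ≤ ∑ n ∈ s with ⌊log (n : ℕ)⌋₊ = j, exp (-j) * f n := Finset.sum_le_sum h1
      _ = exp (-j) * ∑ n ∈ s with ⌊log (n : ℕ)⌋₊ = j, f n := by rw [Finset.mul_sum]
      _ ≤ exp (-j) * ∑ n ∈ Finset.Icc 0 ⌊exp (j + 1)⌋₊, f n := by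
        gcongr
        exact fun n _ _ => hf n
      _ ≤ exp (-j) * (B * exp (j + 1)) := by gcongr; exact hB _ (exp_nonneg _)
      _ = exp 1 * B := by
        have : exp (-j) * exp (j + 1) = exp 1 := by rw [← exp_add]; ring_nf
        linear_combination B * this
  have step2 (n : ℕ) : 1 / (1 + (u - log n) ^ 2) ≤
      3 * (1 / (1 + ((⌊u⌋ - (⌊log n⌋₊ : ℕ) : ℤ) : ℝ) ^ 2)) := by
    have h1 := Int.floor_le u
    have h2 := Int.lt_floor_add_one u
    have h3 := Nat.floor_le (log_natCast_nonneg n)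
    have h4 := Nat.lt_floor_add_one (log n)
    push_cast
    set p : ℝ := (⌊u⌋ : ℝ)
    set r : ℝ := (⌊log n⌋₊ : ℝ)
    rw [mul_one_div, div_le_div_iff₀ (by positivity) (by positivity)]
    set x := u - log n with hx
    have h5 : |p - r| ≤ |x| + 1 := by
      have : |(p - r) - x| ≤ 1 := by rw [abs_le]; constructor <;> linarith
      calc |p - r| = |x + ((p - r) - x)| := by ring_nf
        _ ≤ _ := (abs_add_le _ _).trans (by linarith)
    have h6 : (p - r) ^ 2 ≤ (|x| + 1) ^ 2 := by
      rw [← sq_abs (p - r)]; gcongr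
    nlinarith [sq_nonneg (|x| - 1), sq_abs x]
  calc _ ≤ ∑ n ∈ s, f n / n * (3 * (1 / (1 + ((⌊u⌋ - (⌊log n⌋₊ : ℕ) : ℤ) : ℝ) ^ 2))) := by
        refine Finset.sum_le_sum fun n _ => ?_
        exact mul_le_mul_of_nonneg_left (step2 n) (div_nonneg (hf n) n.cast_nonneg)
    _ = ∑ j ∈ s.image (fun n : ℕ => ⌊log n⌋₊), ∑ n ∈ s with ⌊log (n : ℕ)⌋₊ = j,
          f n / n * (3 * (1 / (1 + ((⌊u⌋ - (⌊log n⌋₊ : ℕ) : ℤ) : ℝ) ^ 2))) :=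
        (Finset.sum_fiberwise_of_maps_to (fun n hn => Finset.mem_image_of_mem _ hn) _).symm
    _ ≤ ∑ j ∈ s.image (fun n : ℕ => ⌊log n⌋₊),
          3 * (exp 1 * B) * (1 / (1 + ((⌊u⌋ - (j : ℕ) : ℤ) : ℝ) ^ 2)) := by
        refine Finset.sum_le_sum fun j _ => ?_
        have : ∑ n ∈ s with ⌊log (n : ℕ)⌋₊ = j,
            f n / n * (3 * (1 / (1 + ((⌊u⌋ - (⌊log n⌋₊ : ℕ) : ℤ) : ℝ) ^ 2))) =
            (∑ n ∈ s with ⌊log (n : ℕ)⌋₊ = j, f n / n) *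
              (3 * (1 / (1 + ((⌊u⌋ - (j : ℕ) : ℤ) : ℝ) ^ 2))) := by
          rw [Finset.sum_mul]
          refine Finset.sum_congr rfl fun n hn => ?_
          rw [(Finset.mem_filter.mp hn).2]
        rw [this]
        calc _ ≤ (exp 1 * B) * (3 * (1 / (1 + ((⌊u⌋ - (j : ℕ) : ℤ) : ℝ) ^ 2))) := by
              gcongr
              exact step1 j
          _ = _ := by ring
    _ = 3 * (exp 1 * B) * ∑ j ∈ s.image (fun n : ℕ => ⌊log n⌋₊),
          (1 / (1 + ((⌊u⌋ - (j : ℕ) : ℤ) : ℝ) ^ 2)) := by rw [Finset.mul_sum]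
    _ ≤ 3 * (exp 1 * B) * A := by
        gcongr
        have hinj : Function.Injective (fun j : ℕ => (⌊u⌋ - (j : ℕ) : ℤ)) := by
          intro a b hab
          simp only at hab
          omega
        rw [← Finset.sum_image (f := fun z : ℤ => 1 / (1 + (z : ℝ) ^ 2))
          (g := fun j : ℕ => (⌊u⌋ - (j : ℕ) : ℤ)) (hinj.injOn)]
        exact summable_one_div_one_add_int_sq.sum_le_tsum _ fun z _ => by positivity

lemma continuous_update_riemannZeta_sub :
    Continuous (Function.update (fun s => riemannZeta s - 1 / (s - 1)) 1
      (Real.eulerMascheroniConstant : ℂ)) := by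
  rw [continuous_iff_continuousAt]
  intro s
  rcases eq_or_ne s 1 with rfl | hs
  · exact continuousAt_update_same.mpr tendsto_riemannZeta_sub_one_div
  · rw [continuousAt_update_of_ne hs]
    refine ContinuousAt.sub (differentiableAt_riemannZeta hs).continuousAt ?_
    refine ContinuousAt.div continuousAt_const (by fun_prop) (sub_ne_zero.mpr hs)

/-- A sequence with a Chebyshev bound, whose Dirichlet series has a simple pole at `1` and is
otherwise continuous up to the line `re s = 1`, has mass in short multiplicative intervals. -/
theorem exists_le_sum_Icc_exp {f : ℕ → ℝ} (hf : ∀ n, 0 ≤ f n) {B κ : ℝ} (hκ : 0 < κ)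
    (hB : ∀ x : ℝ, 0 ≤ x → ∑ n ∈ Finset.Icc 0 ⌊x⌋₊, f n ≤ B * x)
    (hsum : ∀ σ : ℝ, 1 < σ → Summable fun n => f n / (n : ℝ) ^ σ)
    {G : ℂ → ℂ} (hG : ContinuousOn G {s | 1 ≤ s.re})
    (hfG : ∀ s : ℂ, 1 < s.re → LSeries (fun n => (f n : ℂ)) s = G s + κ / (s - 1))
    {c : ℝ} (hc : 0 < c) :
    ∃ δ > 0, ∀ᶠ u in Filter.atTop,
      δ * exp u ≤ ∑ n ∈ Finset.Icc ⌈exp (u - c)⌉₊ ⌊exp (u + c)⌋₊, f n := by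
  obtain ⟨B₀, hB₀, hB₀'⟩ := exists_sum_div_one_add_sq_le hf hB
  set C := 1 + 1 / c ^ 2 with hC
  have hC0 : 0 < C := by positivity
  obtain ⟨T, hT1, hTκ⟩ : ∃ T : ℝ, 1 ≤ T ∧ 2 * C * B₀ / T ≤ κ / 64 := by
    refine ⟨max 1 (2 * C * B₀ / (κ / 64)), le_max_left _ _, ?_⟩
    rw [div_le_iff₀ (by positivity)]
    have := le_max_right 1 (2 * C * B₀ / (κ / 64))
    rw [div_le_iff₀ (by positivity)] at this
    linarith
  have hT : 0 < T := by linarith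
  set Z := Function.update (fun s => riemannZeta s - 1 / (s - 1)) 1
      (Real.eulerMascheroniConstant : ℂ) with hZ
  set Φ : ℂ → ℂ := fun s => G s - κ * Z s with hΦ
  have hΦc : ContinuousOn Φ {s | 1 ≤ s.re} :=
    hG.sub (continuousOn_const.mul continuous_update_riemannZeta_sub.continuousOn)
  have hΦext : Continuous fun p : ℝ × ℝ => Φ ((max p.1 1 : ℝ) + p.2 * Complex.I) := by
    refine hΦc.comp_continuous (by fun_prop) fun p => ?_
    simp
  set R : ℝ → ℝ → ℝ := fun u σ => ∫ t in (0 : ℝ)..T, (1 - t / T) *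
    (Complex.exp (t * u * Complex.I) * Φ ((max σ 1 : ℝ) + t * Complex.I)).re with hR
  have hRc (u : ℝ) : Continuous (R u) := by
    refine intervalIntegral.continuous_parametric_intervalIntegral_of_continuous' ?_ _ _
    have : Continuous fun p : ℝ × ℝ => (Complex.exp (p.2 * u * Complex.I) *
        Φ ((max p.1 1 : ℝ) + p.2 * Complex.I)) := by
      refine Continuous.mul (by fun_prop) hΦext
    refine Continuous.mul (by fun_prop) (Complex.continuous_re.comp this)
  have hRlim : Filter.Tendsto (fun u => R u 1) Filter.atTop (nhds 0) := by
    have h1 := tendsto_integral_exp_mul_atTop T hT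
      (fun t => ((1 - t / T : ℝ) : ℂ) * Φ ((max 1 1 : ℝ) + t * Complex.I))
    have h2 := (Complex.continuous_re.tendsto 0).comp h1
    refine h2.congr fun u => ?_
    simp only [Function.comp, hR]
    have h3 : Continuous fun t : ℝ => Φ ((max 1 1 : ℝ) + t * Complex.I) :=
      hΦext.comp (by fun_prop : Continuous fun t : ℝ => ((1 : ℝ), t))
    have h4 : Continuous fun t : ℝ => Complex.exp (t * u * Complex.I) *
        (((1 - t / T : ℝ) : ℂ) * Φ ((max 1 1 : ℝ) + t * Complex.I)) := by
      refine Continuous.mul (by fun_prop) (Continuous.mul (by fun_prop) h3)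
    have h5 := Complex.reCLM.intervalIntegral_comp_comm
      (h4.intervalIntegrable (μ := MeasureTheory.volume) 0 T)
    simp only [Complex.reCLM_apply] at h5
    rw [← h5]
    congr 1
    ext t
    rw [mul_left_comm, Complex.re_ofReal_mul]
  -- the identity to the right of the line
  have hone (σ : ℝ) (hσ : 1 < σ) : Summable fun n : ℕ => 1 / (n : ℝ) ^ σ :=
    Real.summable_one_div_nat_rpow.mpr hσ
  have hid (u σ : ℝ) (hσ : 1 < σ) :
      HasSum (fun n : ℕ => (f n - κ) / (n : ℝ) ^ σ * fejer T (u - log n)) (R u σ) := by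
    have := hasSum_mul_fejer (fun n => f n - κ) (by linarith : 0 < σ) hT u (by
      refine Summable.of_nonneg_of_le (fun n => by positivity) (fun n => ?_)
        ((hsum σ hσ).add ((hone σ hσ).mul_left κ))
      rw [mul_one_div, ← add_div]
      gcongr
      refine (abs_sub _ _).trans ?_
      rw [abs_of_nonneg (hf n), abs_of_pos hκ])
    convert! this using 1
    simp only [hR]
    congr 1
    ext t
    congr 3
    have hre : 1 < ((σ : ℂ) + t * Complex.I).re := by simpa using hσ
    have hne : (σ : ℂ) + t * Complex.I ≠ 1 := by
      intro h
      rw [h] at hre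
      simp at hre
    rw [max_eq_left hσ.le]
    have hs1 : LSeriesSummable (fun n => (f n : ℂ)) (σ + t * Complex.I) := by
      refine Summable.of_norm_bounded (hsum σ hσ) fun n => ?_
      rcases eq_or_ne n 0 with rfl | hn
      · simp [Real.zero_rpow (by linarith : σ ≠ 0)]
      · rw [LSeries.norm_term_eq]
        simp [hn, abs_of_nonneg (hf n)]
    have hs2 : LSeriesSummable (1 : ℕ → ℂ) (σ + t * Complex.I) := LSeriesSummable_one_iff.mpr hre
    have : (fun n => ((f n - κ : ℝ) : ℂ)) = (fun n => (f n : ℂ)) - (κ : ℂ) • (1 : ℕ → ℂ) := by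
      ext n; simp
    rw [this, LSeries_sub hs1 (hs2.smul _), LSeries_smul, LSeries_one_eq_riemannZeta hre, hfG _ hre]
    simp only [hΦ, hZ, Function.update_of_ne hne]
    ring
  have hfej0 := fejer_nonneg hT
  -- key inequality
  have key (u σ : ℝ) (hσ : 1 < σ) :
      κ * ((⌊exp (u + 1 / T)⌋₊ + 1 - ⌈exp u⌉₊ : ℕ) * (exp (-(σ * (u + 1 / T))) * (T / 4))) + R u σ ≤
      T * (∑ n ∈ Finset.Icc ⌈exp (u - c)⌉₊ ⌊exp (u + c)⌋₊, f n / n) + 2 * C * B₀ / T := by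
    have hs1 : Summable fun n : ℕ => f n / (n : ℝ) ^ σ * fejer T (u - log n) := by
      refine Summable.of_nonneg_of_le
        (fun n => mul_nonneg (div_nonneg (hf n) (by positivity)) (hfej0 _)) (fun n => ?_)
        ((hsum σ hσ).mul_right T)
      exact mul_le_mul_of_nonneg_left (fejer_le hT _) (div_nonneg (hf n) (by positivity))
    have hs2 : Summable fun n : ℕ => 1 / (n : ℝ) ^ σ * fejer T (u - log n) := by
      refine Summable.of_nonneg_of_le
        (fun n => mul_nonneg (by positivity) (hfej0 _)) (fun n => ?_)
        ((hone σ hσ).mul_right T)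
      exact mul_le_mul_of_nonneg_left (fejer_le hT _) (by positivity)
    have hkey : R u σ = (∑' n : ℕ, f n / (n : ℝ) ^ σ * fejer T (u - log n)) -
        κ * ∑' n : ℕ, 1 / (n : ℝ) ^ σ * fejer T (u - log n) := by
      rw [← tsum_mul_left, ← hs1.tsum_sub (hs2.mul_left κ), ← (hid u σ hσ).tsum_eq]
      congr 1
      ext n
      ring
    have hlow : (⌊exp (u + 1 / T)⌋₊ + 1 - ⌈exp u⌉₊ : ℕ) * (exp (-(σ * (u + 1 / T))) * (T / 4)) ≤
        ∑' n : ℕ, 1 / (n : ℝ) ^ σ * fejer T (u - log n) := by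
      refine le_trans ?_ (hs2.sum_le_tsum (Finset.Icc ⌈exp u⌉₊ ⌊exp (u + 1 / T)⌋₊)
        fun n _ => mul_nonneg (by positivity) (hfej0 _))
      rw [← Nat.card_Icc, ← nsmul_eq_mul]
      refine Finset.card_nsmul_le_sum _ _ _ fun n hn => ?_
      rw [Finset.mem_Icc, Nat.ceil_le, Nat.le_floor_iff (exp_nonneg _)] at hn
      have hn0 : (0 : ℝ) < n := (exp_pos u).trans_le hn.1
      have h1 : u ≤ log n := (le_log_iff_exp_le hn0).mpr hn.1
      have h2 : log n ≤ u + 1 / T := (log_le_iff_le_exp hn0).mpr hn.2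
      gcongr
      · rw [one_div ((n : ℝ) ^ σ), ← rpow_neg hn0.le, rpow_def_of_pos hn0]
        refine exp_le_exp.mpr ?_
        nlinarith
      · refine le_fejer hT ?_
        rw [abs_le]
        have h3 : T * (1 / T) = 1 := by field_simp
        constructor <;> nlinarith
    have hup : ∑' n : ℕ, f n / (n : ℝ) ^ σ * fejer T (u - log n) ≤
        T * (∑ n ∈ Finset.Icc ⌈exp (u - c)⌉₊ ⌊exp (u + c)⌋₊, f n / n) + 2 * C * B₀ / T := by
      refine Real.tsum_le_of_sum_le
        (fun n => mul_nonneg (div_nonneg (hf n) (by positivity)) (hfej0 _)) fun s => ?_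
      have hdiv (n : ℕ) : f n / (n : ℝ) ^ σ ≤ f n / n := by
        rcases Nat.eq_zero_or_pos n with rfl | hn
        · simp [Real.zero_rpow (by linarith : σ ≠ 0)]
        · refine div_le_div_of_nonneg_left (hf n) (by positivity) ?_
          have : (1 : ℝ) ≤ n := by exact_mod_cast hn
          simpa using rpow_le_rpow_of_exponent_le this hσ.le
      have hterm : ∀ n ∈ s, f n / (n : ℝ) ^ σ * fejer T (u - log n) ≤
          (if n ∈ Finset.Icc ⌈exp (u - c)⌉₊ ⌊exp (u + c)⌋₊ then T * (f n / n) else 0) +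
          2 * C / T * (f n / n * (1 / (1 + (u - log n) ^ 2))) := by
        intro n _
        have hfn : 0 ≤ f n / n := div_nonneg (hf n) n.cast_nonneg
        split_ifs with hn
        · have h1 : f n / (n : ℝ) ^ σ * fejer T (u - log n) ≤ f n / n * T :=
            mul_le_mul (hdiv n) (fejer_le hT _) (hfej0 _) hfn
          have h2 : 0 ≤ 2 * C / T * (f n / n * (1 / (1 + (u - log n) ^ 2))) := by positivity
          linarith
        · rcases Nat.eq_zero_or_pos n with rfl | hn0
          · simp [Real.zero_rpow (by linarith : σ ≠ 0)]
          have hn0' : (0 : ℝ) < n := by positivity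
          have hx : c ≤ |u - log n| := by
            by_contra! hlt
            rw [abs_lt] at hlt
            apply hn
            rw [Finset.mem_Icc, Nat.ceil_le, Nat.le_floor_iff (exp_nonneg _),
              ← le_log_iff_exp_le hn0', ← log_le_iff_le_exp hn0']
            constructor <;> linarith
          set x := u - log n with hxdef
          have hx0 : x ≠ 0 := by
            intro h; rw [h, abs_zero] at hx; linarith
          have hx2 : c ^ 2 ≤ x ^ 2 := by rw [← sq_abs x]; gcongr
          have hx20 : 0 < x ^ 2 := by positivity
          have h1 : fejer T x ≤ 2 * C / T * (1 / (1 + x ^ 2)) := by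
            refine (fejer_le_div hT hx0).trans ?_
            rw [div_mul_div_comm, div_le_div_iff₀ (by positivity) (by positivity)]
            have : 1 + x ^ 2 ≤ C * x ^ 2 := by
              rw [hC, add_mul, one_mul, add_comm]
              gcongr
              rw [div_mul_eq_mul_div, one_mul, le_div_iff₀ (by positivity)]
              linarith
            nlinarith
          rw [zero_add]
          calc _ ≤ f n / n * (2 * C / T * (1 / (1 + x ^ 2))) :=
                mul_le_mul (hdiv n) h1 (hfej0 _) hfn
            _ = _ := by ring
      refine (Finset.sum_le_sum hterm).trans ?_
      rw [Finset.sum_add_distrib, ← Finset.mul_sum, ← Finset.sum_filter]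
      refine add_le_add ?_ ?_
      · rw [Finset.mul_sum]
        refine Finset.sum_le_sum_of_subset_of_nonneg (fun n hn => (Finset.mem_filter.mp hn).2)
          fun n _ _ => mul_nonneg hT.le (div_nonneg (hf n) n.cast_nonneg)
      · calc _ ≤ 2 * C / T * B₀ := by gcongr; exact hB₀' u s
          _ = _ := by ring
    have := mul_le_mul_of_nonneg_left hlow hκ.le
    linarith
  have key' (u : ℝ) :
      κ * ((⌊exp (u + 1 / T)⌋₊ + 1 - ⌈exp u⌉₊ : ℕ) * (exp (-(1 * (u + 1 / T))) * (T / 4))) + R u 1 ≤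
      T * (∑ n ∈ Finset.Icc ⌈exp (u - c)⌉₊ ⌊exp (u + c)⌋₊, f n / n) + 2 * C * B₀ / T := by
    have hcont : Continuous fun σ : ℝ => κ * ((⌊exp (u + 1 / T)⌋₊ + 1 - ⌈exp u⌉₊ : ℕ) *
        (exp (-(σ * (u + 1 / T))) * (T / 4))) + R u σ := by
      have := hRc u
      fun_prop
    refine le_of_tendsto (x := nhdsWithin (1 : ℝ) (Set.Ioi 1))
      ((hcont.tendsto 1).mono_left nhdsWithin_le_nhds) ?_
    filter_upwards [self_mem_nhdsWithin] with σ hσ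
    exact key u σ hσ
  refine ⟨exp (-c) * (κ / (32 * T)), by positivity, ?_⟩
  have hRsmall : ∀ᶠ u in Filter.atTop, -(κ / 64) < R u 1 :=
    hRlim.eventually (lt_mem_nhds (by linarith [hκ]))
  filter_upwards [hRsmall, Filter.eventually_ge_atTop (log (4 * T))] with u hu1 hu2
  have hTu : 4 * T ≤ exp u := (log_le_iff_le_exp (by positivity)).mp hu2
  have hcard : exp (u + 1 / T) - exp u - 1 ≤ ((⌊exp (u + 1 / T)⌋₊ + 1 - ⌈exp u⌉₊ : ℕ) : ℝ) := by
    have h1 := Nat.lt_floor_add_one (exp (u + 1 / T))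
    have h2 := Nat.ceil_lt_add_one (exp_nonneg u)
    have h3 : ((⌊exp (u + 1 / T)⌋₊ + 1 : ℕ) : ℝ) - (⌈exp u⌉₊ : ℕ) ≤
      ((⌊exp (u + 1 / T)⌋₊ + 1 - ⌈exp u⌉₊ : ℕ) : ℝ) := by
      rw [sub_le_iff_le_add]
      exact_mod_cast Nat.sub_le_iff_le_add.mp le_rfl
    push_cast at h3 ⊢
    linarith
  have hmain : κ / 16 ≤ κ * ((⌊exp (u + 1 / T)⌋₊ + 1 - ⌈exp u⌉₊ : ℕ) *
      (exp (-(1 * (u + 1 / T))) * (T / 4))) := by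
    have h1 : (exp (u + 1 / T) - exp u - 1) * (exp (-(1 * (u + 1 / T))) * (T / 4)) ≤
      ((⌊exp (u + 1 / T)⌋₊ + 1 - ⌈exp u⌉₊ : ℕ) * (exp (-(1 * (u + 1 / T))) * (T / 4))) := by
      gcongr
    have h2 : (exp (u + 1 / T) - exp u - 1) * (exp (-(1 * (u + 1 / T))) * (T / 4)) =
        (1 - exp (-(1 / T)) - exp (-u) * exp (-(1 / T))) * (T / 4) := by
      rw [one_mul, neg_add, exp_add (-u), exp_add u, exp_neg u, exp_neg (1 / T)]
      have := exp_pos u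
      have := exp_pos (1 / T)
      field_simp
    have h3 : exp (-(1 / T)) ≤ 1 - 1 / (2 * T) := by
      rw [exp_neg, inv_le_comm₀ (exp_pos _)]
      · refine le_trans ?_ (add_one_le_exp (1 / T))
        rw [inv_le_iff_one_le_mul₀]
        · have : 1 / T ≤ 1 := by rw [div_le_one hT]; exact hT1
          have h0 : 0 < 1 / T := by positivity
          have : 1 / (2 * T) = (1 / T) / 2 := by field_simp
          rw [this]
          nlinarith
        · rw [sub_pos, div_lt_one (by positivity)]; linarith
      · rw [sub_pos, div_lt_one (by positivity)]; linarith
    have h4 : exp (-u) * exp (-(1 / T)) ≤ 1 / (4 * T) := by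
      have : exp (-(1 / T)) ≤ 1 := exp_le_one_iff.mpr (by rw [neg_nonpos]; positivity)
      have h5 : exp (-u) ≤ 1 / (4 * T) := by
        rw [exp_neg, one_div]; gcongr
      nlinarith [exp_pos (-u)]
    have h5 : 1 / 16 ≤ (1 - exp (-(1 / T)) - exp (-u) * exp (-(1 / T))) * (T / 4) := by
      calc (1 : ℝ) / 16 = (1 / (2 * T) - 1 / (4 * T)) * (T / 4) := by field_simp; norm_num
        _ ≤ _ := by gcongr; linarith
    nlinarith
  have hfin := key' u
  have hI : κ / 32 ≤ T * (∑ n ∈ Finset.Icc ⌈exp (u - c)⌉₊ ⌊exp (u + c)⌋₊, f n / n) := by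
    linarith
  have hI2 : exp (u - c) * (∑ n ∈ Finset.Icc ⌈exp (u - c)⌉₊ ⌊exp (u + c)⌋₊, f n / n) ≤
      ∑ n ∈ Finset.Icc ⌈exp (u - c)⌉₊ ⌊exp (u + c)⌋₊, f n := by
    rw [Finset.mul_sum]
    refine Finset.sum_le_sum fun n hn => ?_
    rw [Finset.mem_Icc, Nat.ceil_le] at hn
    have hn0 : (0 : ℝ) < n := (exp_pos _).trans_le hn.1
    rw [mul_div_assoc', div_le_iff₀ hn0, mul_comm]
    exact mul_le_mul_of_nonneg_left hn.1 (hf n)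
  refine le_trans ?_ hI2
  have hI3 : κ / (32 * T) ≤ ∑ n ∈ Finset.Icc ⌈exp (u - c)⌉₊ ⌊exp (u + c)⌋₊, f n / n := by
    rw [← div_div, div_le_iff₀ hT]; linarith
  calc _ = exp (u - c) * (κ / (32 * T)) := by rw [sub_eq_add_neg, exp_add]; ring
    _ ≤ _ := by gcongr

/-- The von Mangoldt function restricted to `n ≡ 1 (mod 4)`. -/
noncomputable def lambdaOne (n : ℕ) : ℝ :=
  if n % 4 = 1 then ArithmeticFunction.vonMangoldt n else 0

lemma natCast_zmod_four_eq_one_iff (n : ℕ) : (n : ZMod 4) = 1 ↔ n % 4 = 1 := by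
  have := ZMod.natCast_eq_natCast_iff' n 1 4
  simpa using this

lemma lambdaOne_eq : lambdaOne =
    ArithmeticFunction.vonMangoldt.residueClass (1 : ZMod 4) := by
  ext n
  simp only [lambdaOne, ArithmeticFunction.vonMangoldt.residueClass, Set.indicator_apply,
    Set.mem_ofPred_eq, natCast_zmod_four_eq_one_iff]

lemma lambdaOne_nonneg (n : ℕ) : 0 ≤ lambdaOne n := by
  rw [lambdaOne_eq]; exact ArithmeticFunction.vonMangoldt.residueClass_nonneg _ n

lemma lambdaOne_prime {p : ℕ} (hp : p.Prime) (h : p % 4 = 1) : lambdaOne p = log p := by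
  rw [lambdaOne, if_pos h, ArithmeticFunction.vonMangoldt_apply_prime hp]

lemma sum_lambdaOne_le {x : ℝ} (hx : 0 ≤ x) :
    ∑ n ∈ Finset.Icc 0 ⌊x⌋₊, lambdaOne n ≤ (log 4 + 4) * x := by
  refine le_trans ?_ (Chebyshev.psi_le_const_mul_self hx)
  rw [Chebyshev.psi_eq_sum_Icc, lambdaOne_eq]
  exact Finset.sum_le_sum fun n _ => ArithmeticFunction.vonMangoldt.residueClass_le _ n

lemma summable_lambdaOne_div_rpow {σ : ℝ} (hσ : 1 < σ) :
    Summable fun n => lambdaOne n / (n : ℝ) ^ σ := by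
  rw [lambdaOne_eq]
  exact LSeries.summable_real_of_abscissaOfAbsConv_lt <|
    (ArithmeticFunction.vonMangoldt.abscissaOfAbsConv_residueClass_le_one _).trans_lt <|
      mod_cast hσ

lemma summable_lambdaOne_nonprime_div :
    Summable fun n : ℕ => (if n.Prime then 0 else lambdaOne n) / (n : ℝ) := by
  rw [lambdaOne_eq]
  exact ArithmeticFunction.vonMangoldt.summable_residueClass_non_primes_div (1 : ZMod 4)

lemma exists_LSeries_lambdaOne_eq : ∃ G : ℂ → ℂ, ContinuousOn G {s | 1 ≤ s.re} ∧
    ∀ s : ℂ, 1 < s.re →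
      LSeries (fun n => (lambdaOne n : ℂ)) s = G s + ((1 / 2 : ℝ) : ℂ) / (s - 1) := by
  refine ⟨ArithmeticFunction.vonMangoldt.LFunctionResidueClassAux (1 : ZMod 4),
    ArithmeticFunction.vonMangoldt.continuousOn_LFunctionResidueClassAux _, fun s hs => ?_⟩
  have h := ArithmeticFunction.vonMangoldt.eqOn_LFunctionResidueClassAux
    (isUnit_one : IsUnit (1 : ZMod 4)) hs
  have h4 : Nat.totient 4 = 2 := by decide
  rw [lambdaOne_eq, h, h4]
  push_cast
  ring

lemma LSeries_ofReal (c : ℕ → ℝ) {σ : ℝ} (hσ : 0 < σ) :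
    LSeries (fun n => (c n : ℂ)) σ = ((∑' n : ℕ, c n / (n : ℝ) ^ σ : ℝ) : ℂ) := by
  rw [Complex.ofReal_tsum, LSeries]
  congr 1
  ext n
  rcases eq_or_ne n 0 with rfl | hn
  · simp [Real.zero_rpow hσ.ne']
  · rw [LSeries.term_of_ne_zero hn]
    push_cast
    rw [Complex.ofReal_cpow n.cast_nonneg]
    simp

lemma exists_abs_tsum_lambdaOne_sub_le : ∃ C, ∀ σ : ℝ, 1 < σ → σ ≤ 2 →
    |∑' n, lambdaOne n / (n : ℝ) ^ σ - 1 / 2 / (σ - 1)| ≤ C := by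
  obtain ⟨G, hG, hGe⟩ := exists_LSeries_lambdaOne_eq
  have hc : ContinuousOn (fun x : ℝ => G x) (Set.Icc 1 2) :=
    hG.comp Complex.continuous_ofReal.continuousOn fun x hx => by simpa using hx.1
  obtain ⟨C, hC⟩ := isCompact_Icc.exists_bound_of_continuousOn hc
  refine ⟨C, fun σ h1 h2 => ?_⟩
  have h := hGe σ (by simpa using h1)
  rw [LSeries_ofReal _ (by linarith)] at h
  have h3 := hC σ ⟨h1.le, h2⟩
  have h4 : G σ = ((∑' n, lambdaOne n / (n : ℝ) ^ σ - 1 / 2 / (σ - 1) : ℝ) : ℂ) := by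
    rw [Complex.ofReal_sub, h]
    push_cast
    ring
  rwa [h4, Complex.norm_real, Real.norm_eq_abs] at h3

/-- Primes `p ≡ 1 (mod 4)` in short multiplicative intervals. -/
theorem exists_le_card_primes {a b : ℝ} (ha : 0 < a) (hab : a < b) :
    ∃ δ > 0, ∀ᶠ Y in Filter.atTop, δ * Y / log Y ≤
      ((Finset.Icc ⌈a * Y⌉₊ ⌊b * Y⌋₊).filter (fun p => p.Prime ∧ p % 4 = 1)).card := by
  have hb : 0 < b := ha.trans hab
  obtain ⟨G, hG, hGe⟩ := exists_LSeries_lambdaOne_eq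
  have hc : 0 < log (b / a) / 2 := half_pos (log_pos (by rwa [one_lt_div ha]))
  obtain ⟨δ, hδ, hev⟩ := exists_le_sum_Icc_exp lambdaOne_nonneg one_half_pos
    (fun x hx => sum_lambdaOne_le hx) (fun σ hσ => summable_lambdaOne_div_rpow hσ) hG hGe hc
  set m := exp ((log a + log b) / 2) with hm
  have hm0 : 0 < m := exp_pos _
  have hev' := (Filter.tendsto_atTop_add_const_right _ ((log a + log b) / 2)
    tendsto_log_atTop).eventually hev
  have hε : 0 < δ * m / (2 * b) := by positivity
  obtain ⟨s, hs⟩ := summable_iff_vanishing_norm.mp summable_lambdaOne_nonprime_div _ hε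
  refine ⟨δ * m / 4, by positivity, ?_⟩
  filter_upwards [hev', Filter.eventually_gt_atTop 1, Filter.eventually_ge_atTop b,
    Filter.eventually_gt_atTop (((s.sup id : ℕ) : ℝ) / a)] with Y hY hY1 hYb hYs
  have hY0 : 0 < Y := by linarith
  have e1 : exp (log Y + (log a + log b) / 2 - log (b / a) / 2) = a * Y := by
    rw [log_div hb.ne' ha.ne', show log Y + (log a + log b) / 2 - (log b - log a) / 2 =
      log a + log Y by ring, exp_add, exp_log ha, exp_log hY0]
  have e2 : exp (log Y + (log a + log b) / 2 + log (b / a) / 2) = b * Y := by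
    rw [log_div hb.ne' ha.ne', show log Y + (log a + log b) / 2 + (log b - log a) / 2 =
      log b + log Y by ring, exp_add, exp_log hb, exp_log hY0]
  rw [e1, e2, exp_add, exp_log hY0, ← hm] at hY
  set I := Finset.Icc ⌈a * Y⌉₊ ⌊b * Y⌋₊ with hI
  have hlogY : 0 < log Y := log_pos hY1
  have hmem : ∀ n ∈ I, a * Y ≤ n ∧ (n : ℝ) ≤ b * Y := by
    intro n hn
    rwa [hI, Finset.mem_Icc, Nat.ceil_le, Nat.le_floor_iff (by positivity)] at hn
  have hdisj : Disjoint I s := by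
    rw [Finset.disjoint_left]
    intro n hn hns
    have h1 : n ≤ s.sup id := Finset.le_sup (f := id) hns
    have h2 : (n : ℝ) ≤ (s.sup id : ℕ) := by exact_mod_cast h1
    have h3 := (hmem n hn).1
    rw [div_lt_iff₀ ha] at hYs
    linarith
  have hnp := (abs_lt.mp (hs I hdisj)).2
  have hsplit : ∑ n ∈ I, lambdaOne n =
      ∑ n ∈ I, (if n.Prime then lambdaOne n else 0) + ∑ n ∈ I, (if n.Prime then 0 else lambdaOne n) := by
    rw [← Finset.sum_add_distrib]
    refine Finset.sum_congr rfl fun n _ => ?_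
    split_ifs <;> simp
  have hnp2 : ∑ n ∈ I, (if n.Prime then 0 else lambdaOne n) ≤ δ * m / 2 * Y := by
    calc _ ≤ ∑ n ∈ I, b * Y * ((if n.Prime then 0 else lambdaOne n) / n) := by
          refine Finset.sum_le_sum fun n hn => ?_
          have h0 : (0 : ℝ) < n := lt_of_lt_of_le (by positivity) (hmem n hn).1
          have h1 : 0 ≤ (if n.Prime then 0 else lambdaOne n) := by
            split_ifs
            exacts [le_rfl, lambdaOne_nonneg n]
          rw [mul_div_assoc', le_div_iff₀ h0, mul_comm]
          exact mul_le_mul_of_nonneg_right (hmem n hn).2 h1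
      _ = b * Y * ∑ n ∈ I, ((if n.Prime then 0 else lambdaOne n) / n) := by rw [Finset.mul_sum]
      _ ≤ b * Y * (δ * m / (2 * b)) := by gcongr
      _ = _ := by field_simp
  have hp : ∑ n ∈ I, (if n.Prime then lambdaOne n else 0) ≤
      (I.filter (fun p => p.Prime ∧ p % 4 = 1)).card * (2 * log Y) := by
    rw [← nsmul_eq_mul, ← Finset.sum_const, Finset.sum_filter]
    refine Finset.sum_le_sum fun n hn => ?_
    by_cases h1 : n.Prime
    · by_cases h2 : n % 4 = 1
      · rw [if_pos h1, if_pos ⟨h1, h2⟩, lambdaOne_prime h1 h2]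
        have h3 : log n ≤ log (b * Y) := log_le_log (by exact_mod_cast h1.pos) (hmem n hn).2
        rw [log_mul hb.ne' hY0.ne'] at h3
        have h4 := log_le_log hb hYb
        linarith
      · simp [lambdaOne, h2]
    · simp [h1]
  rw [div_le_iff₀ hlogY]
  linarith

/-- The indicator function of the primes `p ≡ 1 (mod 4)`. -/
noncomputable def primeOne (n : ℕ) : ℝ := if n.Prime ∧ n % 4 = 1 then 1 else 0

lemma primeOne_nonneg (n : ℕ) : 0 ≤ primeOne n := by
  unfold primeOne; split_ifs <;> norm_num

lemma primeOne_le_one (n : ℕ) : primeOne n ≤ 1 := by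
  unfold primeOne; split_ifs <;> norm_num

lemma log_mul_primeOne (n : ℕ) :
    log n * primeOne n = lambdaOne n - if n.Prime then 0 else lambdaOne n := by
  by_cases h1 : n.Prime
  · by_cases h2 : n % 4 = 1
    · simp [primeOne, h1, h2, lambdaOne_prime h1 h2]
    · simp [primeOne, h2, lambdaOne]
  · simp [primeOne, h1]

lemma summable_primeOne_div_rpow {σ : ℝ} (hσ : 1 < σ) :
    Summable fun n => primeOne n / (n : ℝ) ^ σ := by
  refine Summable.of_nonneg_of_le (fun n => div_nonneg (primeOne_nonneg n) (by positivity))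
    (fun n => ?_) (Real.summable_one_div_nat_rpow.mpr hσ)
  gcongr
  exact primeOne_le_one n

lemma log_mul_primeOne_nonneg (n : ℕ) : 0 ≤ log n * primeOne n :=
  mul_nonneg (log_natCast_nonneg n) (primeOne_nonneg n)

lemma log_mul_primeOne_le (n : ℕ) : log n * primeOne n ≤ lambdaOne n := by
  rw [log_mul_primeOne]
  have := lambdaOne_nonneg n
  split_ifs <;> linarith

lemma summable_log_mul_primeOne_div_rpow {σ : ℝ} (hσ : 1 < σ) :
    Summable fun n : ℕ => log n * primeOne n / (n : ℝ) ^ σ := by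
  refine Summable.of_nonneg_of_le (fun n => div_nonneg (log_mul_primeOne_nonneg n) (by positivity))
    (fun n => ?_) (summable_lambdaOne_div_rpow hσ)
  gcongr
  exact log_mul_primeOne_le n

lemma exists_abs_tsum_log_mul_primeOne_sub_le : ∃ C, ∀ σ : ℝ, 1 < σ → σ ≤ 2 →
    |∑' n : ℕ, log n * primeOne n / (n : ℝ) ^ σ - 1 / 2 / (σ - 1)| ≤ C := by
  obtain ⟨C, hC⟩ := exists_abs_tsum_lambdaOne_sub_le
  set D := ∑' n : ℕ, (if n.Prime then 0 else lambdaOne n) / (n : ℝ) with hD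
  refine ⟨C + D, fun σ h1 h2 => ?_⟩
  have hle : ∀ n : ℕ, (if n.Prime then 0 else lambdaOne n) / (n : ℝ) ^ σ ≤
      (if n.Prime then 0 else lambdaOne n) / (n : ℝ) := by
    intro n
    have h0 : 0 ≤ (if n.Prime then 0 else lambdaOne n) := by
      split_ifs
      exacts [le_rfl, lambdaOne_nonneg n]
    rcases Nat.eq_zero_or_pos n with rfl | hn
    · simp [lambdaOne]
    · have hn' : (1 : ℝ) ≤ n := by exact_mod_cast hn
      have : (n : ℝ) ≤ (n : ℝ) ^ σ := by
        simpa using rpow_le_rpow_of_exponent_le hn' h1.le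
      gcongr
  have hnn : ∀ n : ℕ, 0 ≤ (if n.Prime then 0 else lambdaOne n) / (n : ℝ) ^ σ := by
    intro n
    refine div_nonneg ?_ (by positivity)
    split_ifs
    exacts [le_rfl, lambdaOne_nonneg n]
  have hs := Summable.of_nonneg_of_le hnn hle summable_lambdaOne_nonprime_div
  have h3 := Summable.tsum_le_tsum hle hs summable_lambdaOne_nonprime_div
  have h4 : 0 ≤ ∑' n : ℕ, (if n.Prime then 0 else lambdaOne n) / (n : ℝ) ^ σ := tsum_nonneg hnn
  have h5 : ∑' n : ℕ, log n * primeOne n / (n : ℝ) ^ σ = ∑' n, lambdaOne n / (n : ℝ) ^ σ -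
      ∑' n : ℕ, (if n.Prime then 0 else lambdaOne n) / (n : ℝ) ^ σ := by
    rw [← (summable_lambdaOne_div_rpow h1).tsum_sub hs]
    congr 1
    ext n
    rw [log_mul_primeOne, sub_div]
  have h6 := hC σ h1 h2
  rw [abs_le] at h6 ⊢
  rw [h5]
  constructor <;> linarith [h6.1, h6.2]

lemma hasDerivAt_tsum_primeOne {σ : ℝ} (hσ : 1 < σ) :
    HasDerivAt (fun σ : ℝ => ∑' n, primeOne n / (n : ℝ) ^ σ)
      (-∑' n : ℕ, log n * primeOne n / (n : ℝ) ^ σ) σ := by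
  have habs : LSeries.abscissaOfAbsConv (fun n => (primeOne n : ℂ)) < ((σ : ℂ)).re := by
    refine lt_of_le_of_lt (LSeries.abscissaOfAbsConv_le_of_le_const ⟨1, fun n _ => ?_⟩) ?_
    · rw [Complex.norm_real, norm_of_nonneg (primeOne_nonneg n)]
      exact primeOne_le_one n
    · simpa using mod_cast hσ
  have h := (LSeries_hasDerivAt habs).real_of_complex
  have e : LSeries.logMul (fun n => (primeOne n : ℂ)) =
      fun n : ℕ => ((log n * primeOne n : ℝ) : ℂ) := by
    ext n
    simp [LSeries.logMul, Complex.ofReal_log]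
  rw [e, LSeries_ofReal _ (by linarith), ← Complex.ofReal_neg, Complex.ofReal_re] at h
  refine h.congr_of_eventuallyEq ?_
  filter_upwards [lt_mem_nhds hσ] with τ hτ
  rw [LSeries_ofReal _ (by linarith), Complex.ofReal_re]

lemma exists_abs_tsum_primeOne_add_log_le : ∃ C, ∀ σ : ℝ, 1 < σ → σ ≤ 2 →
    |∑' n, primeOne n / (n : ℝ) ^ σ + 1 / 2 * log (σ - 1)| ≤ C := by
  obtain ⟨C, hC⟩ := exists_abs_tsum_log_mul_primeOne_sub_le
  set h : ℝ → ℝ := fun σ => ∑' n, primeOne n / (n : ℝ) ^ σ + 1 / 2 * log (σ - 1) with hh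
  have hder : ∀ σ ∈ Set.Ioc (1 : ℝ) 2, HasDerivWithinAt h
      (-∑' n : ℕ, log n * primeOne n / (n : ℝ) ^ σ + 1 / 2 * (1 / (σ - 1))) (Set.Ioc 1 2) σ := by
    intro σ hσ
    refine HasDerivAt.hasDerivWithinAt ?_
    refine (hasDerivAt_tsum_primeOne hσ.1).add ?_
    refine HasDerivAt.const_mul _ ?_
    exact ((hasDerivAt_id σ).sub_const 1).log (by simpa using (sub_pos.mpr hσ.1).ne')
  have hbd : ∀ σ ∈ Set.Ioc (1 : ℝ) 2,
      ‖-∑' n : ℕ, log n * primeOne n / (n : ℝ) ^ σ + 1 / 2 * (1 / (σ - 1))‖ ≤ C := by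
    intro σ hσ
    rw [Real.norm_eq_abs, ← abs_neg]
    convert hC σ hσ.1 hσ.2 using 2
    ring
  have hC0 : 0 ≤ C := (norm_nonneg _).trans (hbd 2 (by norm_num))
  refine ⟨C + |h 2|, fun σ h1 h2 => ?_⟩
  have h3 := (convex_Ioc (1 : ℝ) 2).norm_image_sub_le_of_norm_hasDerivWithin_le hder hbd
    (show (2 : ℝ) ∈ Set.Ioc (1 : ℝ) 2 by norm_num) (show σ ∈ Set.Ioc (1 : ℝ) 2 from ⟨h1, h2⟩)
  have h4 : ‖σ - 2‖ ≤ 1 := by rw [Real.norm_eq_abs, abs_le]; constructor <;> linarith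
  have h5 : |h σ - h 2| ≤ C := by
    rw [← Real.norm_eq_abs]
    nlinarith
  calc |h σ| = |(h σ - h 2) + h 2| := by rw [sub_add_cancel]
    _ ≤ |h σ - h 2| + |h 2| := abs_add_le _ _
    _ ≤ _ := by linarith

/-- The primes `p ≡ 1 (mod 4)` up to `x`. -/
noncomputable def primesOne (x : ℝ) : Finset ℕ :=
  (Finset.Icc 0 ⌊x⌋₊).filter fun p => p.Prime ∧ p % 4 = 1

lemma mem_primesOne {x : ℝ} (hx : 0 ≤ x) {p : ℕ} :
    p ∈ primesOne x ↔ (p : ℝ) ≤ x ∧ p.Prime ∧ p % 4 = 1 := by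
  simp [primesOne, Nat.le_floor_iff hx]

lemma one_le_log_of_three_le {x : ℝ} (hx : 3 ≤ x) : 1 ≤ log x := by
  rw [le_log_iff_exp_le (by linarith)]
  linarith [exp_one_lt_d9]

lemma rpow_one_add_inv_log_le {x y : ℝ} (hx : 1 < x) (hy : 0 < y) (hyx : y ≤ x) :
    y ^ (1 + 1 / log x) ≤ exp 1 * y := by
  have h : 0 < log x := log_pos hx
  rw [rpow_add hy, rpow_one, mul_comm]
  gcongr
  rw [rpow_def_of_pos hy]
  gcongr
  rw [mul_one_div, div_le_one h]
  exact log_le_log hy hyx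

lemma exists_sum_log_div_le : ∃ C, 0 ≤ C ∧ ∀ x : ℝ, 3 ≤ x →
    ∑ p ∈ primesOne x, log p / (p : ℝ) ≤ C * log x := by
  obtain ⟨C, hC⟩ := exists_abs_tsum_log_mul_primeOne_sub_le
  have hC0 : 0 ≤ C := (abs_nonneg _).trans (hC 2 (by norm_num) le_rfl)
  refine ⟨exp 1 * (1 / 2 + C), by positivity, fun x hx => ?_⟩
  have hlog := one_le_log_of_three_le hx
  have hσ : 1 < 1 + 1 / log x := by
    have : 0 < 1 / log x := by positivity
    linarith
  have hσ2 : 1 + 1 / log x ≤ 2 := by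
    have : 1 / log x ≤ 1 := by rw [div_le_one (by linarith)]; exact hlog
    linarith
  have h1 := (abs_le.mp (hC _ hσ hσ2)).2
  rw [add_sub_cancel_left, div_div_eq_mul_div, div_one] at h1
  calc _ ≤ ∑ p ∈ primesOne x, exp 1 * (log p * primeOne p / (p : ℝ) ^ (1 + 1 / log x)) := by
        refine Finset.sum_le_sum fun p hp => ?_
        obtain ⟨hpx, hp1, hp2⟩ := (mem_primesOne (by linarith)).mp hp
        have hp0 : (0 : ℝ) < p := by exact_mod_cast hp1.pos
        rw [primeOne, if_pos ⟨hp1, hp2⟩, mul_one, mul_div_assoc',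
          div_le_div_iff₀ hp0 (by positivity)]
        have := mul_le_mul_of_nonneg_left (rpow_one_add_inv_log_le (by linarith) hp0 hpx)
          (log_natCast_nonneg p)
        linarith
    _ = exp 1 * ∑ p ∈ primesOne x, (log p * primeOne p / (p : ℝ) ^ (1 + 1 / log x)) := by
        rw [Finset.mul_sum]
    _ ≤ exp 1 * ∑' p : ℕ, (log p * primeOne p / (p : ℝ) ^ (1 + 1 / log x)) := by
        gcongr
        exact (summable_log_mul_primeOne_div_rpow hσ).sum_le_tsum _ fun n _ =>
          div_nonneg (log_mul_primeOne_nonneg n) (by positivity)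
    _ ≤ exp 1 * ((1 / 2 + C) * log x) := by
        gcongr
        nlinarith
    _ = _ := by ring

/-- Mertens' second theorem for the primes `p ≡ 1 (mod 4)`. -/
theorem exists_abs_sum_primesOne_sub_le : ∃ C, 0 ≤ C ∧ ∀ x : ℝ, 3 ≤ x →
    |∑ p ∈ primesOne x, 1 / (p : ℝ) - 1 / 2 * log (log x)| ≤ C := by
  obtain ⟨C₁, hC₁⟩ := exists_abs_tsum_log_mul_primeOne_sub_le
  obtain ⟨C₂, hC₂⟩ := exists_abs_tsum_primeOne_add_log_le
  obtain ⟨C₃, hC₃0, hC₃⟩ := exists_sum_log_div_le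
  have hC₁0 : 0 ≤ C₁ := (abs_nonneg _).trans (hC₁ 2 (by norm_num) le_rfl)
  have hC₂0 : 0 ≤ C₂ := (abs_nonneg _).trans (hC₂ 2 (by norm_num) le_rfl)
  refine ⟨C₂ + C₃ + (1 / 2 + C₁), by positivity, fun x hx => ?_⟩
  have hlog := one_le_log_of_three_le hx
  have hlog0 : 0 < log x := by linarith
  set η := 1 / log x with hη
  have hη0 : 0 < η := by positivity
  have hσ : 1 < 1 + η := by linarith
  have hη1 : η ≤ 1 := by rw [hη, div_le_one (by linarith)]; exact hlog
  have hσ2 : 1 + η ≤ 2 := by linarith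
  have h1 := (abs_le.mp (hC₁ _ hσ hσ2)).2
  have h2 := abs_le.mp (hC₂ _ hσ hσ2)
  have hlη : log (1 + η - 1) = - log (log x) := by
    rw [add_sub_cancel_left, hη, one_div, log_inv]
  rw [hlη] at h2
  rw [add_sub_cancel_left] at h1
  have hx0 : 0 ≤ x := by linarith
  have key : ∀ p ∈ primesOne x, primeOne p / (p : ℝ) ^ (1 + η) = (p : ℝ) ^ (-η) * (1 / p) := by
    intro p hp
    obtain ⟨hpx, hp1, hp2⟩ := (mem_primesOne hx0).mp hp
    have hp0 : (0 : ℝ) < p := by exact_mod_cast hp1.pos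
    rw [primeOne, if_pos ⟨hp1, hp2⟩, rpow_add hp0, rpow_one, rpow_neg hp0.le]
    field_simp
  have hsumle : ∑ p ∈ primesOne x, primeOne p / (p : ℝ) ^ (1 + η) ≤
      ∑' p : ℕ, primeOne p / (p : ℝ) ^ (1 + η) :=
    (summable_primeOne_div_rpow hσ).sum_le_tsum _ fun n _ =>
      div_nonneg (primeOne_nonneg n) (by positivity)
  have hup : ∑ p ∈ primesOne x, 1 / (p : ℝ) ≤
      ∑ p ∈ primesOne x, primeOne p / (p : ℝ) ^ (1 + η) + C₃ := by
    have h3 : ∑ p ∈ primesOne x, 1 / (p : ℝ) ≤ ∑ p ∈ primesOne x,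
        (primeOne p / (p : ℝ) ^ (1 + η) + η * (log p / p)) := by
      refine Finset.sum_le_sum fun p hp => ?_
      rw [key p hp]
      obtain ⟨hpx, hp1, hp2⟩ := (mem_primesOne hx0).mp hp
      have hp0 : (0 : ℝ) < p := by exact_mod_cast hp1.pos
      have h4 : 1 - η * log p ≤ (p : ℝ) ^ (-η) := by
        rw [rpow_def_of_pos hp0]
        have := add_one_le_exp (log p * -η)
        linarith
      have h5 := mul_le_mul_of_nonneg_right h4 (show (0 : ℝ) ≤ 1 / p by positivity)
      have h6 : η * (log p / p) = η * log p * (1 / p) := by ring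
      rw [h6]
      linarith
    rw [Finset.sum_add_distrib, ← Finset.mul_sum] at h3
    have h7 := mul_le_mul_of_nonneg_left (hC₃ x hx) hη0.le
    have h8 : η * (C₃ * log x) = C₃ := by rw [hη]; field_simp
    linarith
  have hlow : ∑' p : ℕ, primeOne p / (p : ℝ) ^ (1 + η) ≤
      ∑ p ∈ primesOne x, 1 / (p : ℝ) + (1 / 2 + C₁) := by
    have hs2 := (summable_log_mul_primeOne_div_rpow hσ).mul_left η
    have hterm : ∀ n : ℕ, primeOne n / (n : ℝ) ^ (1 + η) ≤
        (if n ∈ primesOne x then 1 / (n : ℝ) else 0) +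
          η * (log n * primeOne n / (n : ℝ) ^ (1 + η)) := by
      intro n
      have hnn := div_nonneg (log_mul_primeOne_nonneg n)
        (show (0 : ℝ) ≤ (n : ℝ) ^ (1 + η) by positivity)
      split_ifs with hn
      · rw [key n hn]
        obtain ⟨hpx, hp1, hp2⟩ := (mem_primesOne hx0).mp hn
        have hp1' : (1 : ℝ) ≤ n := by exact_mod_cast hp1.one_le
        have h4 : (n : ℝ) ^ (-η) ≤ 1 := rpow_le_one_of_one_le_of_nonpos hp1' (by linarith)
        have h5 := mul_le_mul_of_nonneg_right h4 (show (0 : ℝ) ≤ 1 / n by positivity)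
        nlinarith
      · by_cases hp : n.Prime ∧ n % 4 = 1
        · have hnx : x < n := by
            by_contra! h
            exact hn ((mem_primesOne hx0).mpr ⟨h, hp⟩)
          have h4 : log x ≤ log n := log_le_log (by linarith) hnx.le
          have h5 : 1 ≤ η * log n := by
            rw [hη, one_div, ← div_eq_inv_mul, one_le_div hlog0]
            exact h4
          have h6 : 0 ≤ primeOne n / (n : ℝ) ^ (1 + η) :=
            div_nonneg (primeOne_nonneg n) (by positivity)
          rw [zero_add, mul_div_assoc, ← mul_assoc]
          nlinarith
        · simp [primeOne, hp]
    have hs1 : Summable fun n : ℕ => if n ∈ primesOne x then 1 / (n : ℝ) else 0 :=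
      summable_of_ne_finset_zero (s := primesOne x) fun n hn => if_neg hn
    have h9 := Summable.tsum_le_tsum hterm (summable_primeOne_div_rpow hσ) (hs1.add hs2)
    rw [hs1.tsum_add hs2, tsum_mul_left, tsum_eq_sum (s := primesOne x) fun n hn => if_neg hn,
      Finset.sum_congr rfl fun n hn => if_pos hn] at h9
    have h10 := mul_le_mul_of_nonneg_left h1 hη0.le
    have h11 : η * (1 / 2 / η) = 1 / 2 := by field_simp
    nlinarith
  rw [abs_le]
  constructor <;> nlinarith [h2.1, h2.2]

lemma A1_of_dvd {m n : ℕ} (hn : n ∈ A1) (h : m ∣ n) : m ∈ A1 :=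
  ⟨Nat.pos_of_dvd_of_pos h hn.1, fun p hp hpm => hn.2 p hp (hpm.trans h)⟩

open Classical in
/-- The prime powers up to `x` whose prime is `≡ 1 (mod 4)`. -/
noncomputable def primePowersOne (x : ℝ) : Finset ℕ :=
  (Finset.Icc 0 ⌊x⌋₊).filter fun q => IsPrimePow q ∧ q ∈ A1

open Classical in
/-- The elements of `A1` up to `x` with `k` prime divisors. -/
noncomputable def A1Upto (k : ℕ) (x : ℝ) : Finset ℕ :=
  (Finset.Icc 0 ⌊x⌋₊).filter fun n => n ∈ A1 ∧ n.primeFactors.card = k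

lemma mem_primePowersOne {x : ℝ} (hx : 0 ≤ x) {q : ℕ} :
    q ∈ primePowersOne x ↔ (q : ℝ) ≤ x ∧ IsPrimePow q ∧ q ∈ A1 := by
  simp [primePowersOne, Nat.le_floor_iff hx]

lemma mem_A1Upto {x : ℝ} (hx : 0 ≤ x) {k n : ℕ} :
    n ∈ A1Upto k x ↔ (n : ℝ) ≤ x ∧ n ∈ A1 ∧ n.primeFactors.card = k := by
  simp [A1Upto, Nat.le_floor_iff hx]

lemma one_le_lambdaOne {q : ℕ} (hq : IsPrimePow q) (hqA : q ∈ A1) : 1 ≤ lambdaOne q := by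
  obtain ⟨p, k, hp, hk, rfl⟩ := hq
  have hp' := hp.nat_prime
  have hp1 : p % 4 = 1 := hqA.2 p hp' (dvd_pow_self p hk.ne')
  have h1 : p ^ k % 4 = 1 := by rw [Nat.pow_mod, hp1]; simp
  rw [lambdaOne, if_pos h1, ArithmeticFunction.vonMangoldt_apply_pow hk.ne',
    ArithmeticFunction.vonMangoldt_apply_prime hp']
  have h2 := hp'.two_le
  exact one_le_log_of_three_le (by exact_mod_cast (by omega : 3 ≤ p))

lemma exists_sum_primePowersOne_le : ∃ C, ∀ x : ℝ, 3 ≤ x →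
    ∑ q ∈ primePowersOne x, 1 / (q : ℝ) ≤ 1 / 2 * log (log x) + C := by
  obtain ⟨C, -, hC⟩ := exists_abs_sum_primesOne_sub_le
  set D := ∑' n : ℕ, (if n.Prime then 0 else lambdaOne n) / (n : ℝ) with hD
  refine ⟨C + D, fun x hx => ?_⟩
  have h1 := (abs_le.mp (hC x hx)).2
  have hnn : ∀ n : ℕ, 0 ≤ (if n.Prime then 0 else lambdaOne n) / (n : ℝ) := by
    intro n
    refine div_nonneg ?_ (by positivity)
    split_ifs
    exacts [le_rfl, lambdaOne_nonneg n]
  have h2 : ∑ n ∈ primePowersOne x, (if n.Prime then 0 else lambdaOne n) / (n : ℝ) ≤ D :=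
    summable_lambdaOne_nonprime_div.sum_le_tsum _ fun n _ => hnn n
  have h3 : ∑ q ∈ primePowersOne x, 1 / (q : ℝ) ≤
      ∑ q ∈ primePowersOne x, ((if q ∈ primesOne x then 1 / (q : ℝ) else 0) +
        (if q.Prime then 0 else lambdaOne q) / (q : ℝ)) := by
    refine Finset.sum_le_sum fun q hq => ?_
    obtain ⟨hqx, hq1, hq2⟩ := (mem_primePowersOne (by linarith)).mp hq
    by_cases hp : q.Prime
    · have : q ∈ primesOne x :=
        (mem_primesOne (by linarith)).mpr ⟨hqx, hp, hq2.2 q hp dvd_rfl⟩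
      simp [this, hp]
    · have : q ∉ primesOne x := fun h => hp ((mem_primesOne (by linarith)).mp h).2.1
      rw [if_neg this, if_neg hp, zero_add]
      gcongr
      exact one_le_lambdaOne hq1 hq2
  rw [Finset.sum_add_distrib, Finset.sum_ite_mem] at h3
  have h4 : ∑ q ∈ primePowersOne x ∩ primesOne x, 1 / (q : ℝ) ≤ ∑ q ∈ primesOne x, 1 / (q : ℝ) :=
    Finset.sum_le_sum_of_subset_of_nonneg Finset.inter_subset_right fun _ _ _ => by positivity
  linarith

lemma sum_le_sum_of_injOn_maps {ι κ : Type*} [DecidableEq κ] {s : Finset ι} {t : Finset κ}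
    (e : ι → κ) (he : ∀ i ∈ s, e i ∈ t) (hinj : Set.InjOn e s) {f : ι → ℝ} {g : κ → ℝ}
    (hg : ∀ j ∈ t, 0 ≤ g j) (hfg : ∀ i ∈ s, f i ≤ g (e i)) : ∑ i ∈ s, f i ≤ ∑ j ∈ t, g j := by
  calc _ ≤ ∑ i ∈ s, g (e i) := Finset.sum_le_sum hfg
    _ = ∑ j ∈ s.image e, g j := (Finset.sum_image hinj).symm
    _ ≤ _ := Finset.sum_le_sum_of_subset_of_nonneg (Finset.image_subset_iff.mpr he)
      fun j hj _ => hg j hj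

lemma succ_mul_sum_A1Upto_le (k : ℕ) {x : ℝ} (hx : 0 ≤ x) :
    (k + 1) * ∑ m ∈ A1Upto (k + 1) x, 1 / (m : ℝ) ≤
      (∑ q ∈ primePowersOne x, 1 / (q : ℝ)) * ∑ m ∈ A1Upto k x, 1 / (m : ℝ) := by
  have h1 : (k + 1) * ∑ m ∈ A1Upto (k + 1) x, 1 / (m : ℝ) =
      ∑ i ∈ (A1Upto (k + 1) x).sigma fun m => m.primeFactors, 1 / (i.1 : ℝ) := by
    rw [Finset.sum_sigma, Finset.mul_sum]
    refine Finset.sum_congr rfl fun m hm => ?_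
    dsimp only
    rw [Finset.sum_const, ((mem_A1Upto hx).mp hm).2.2, nsmul_eq_mul]
    push_cast
    ring
  rw [h1, Finset.sum_mul_sum, ← Finset.sum_product']
  refine sum_le_sum_of_injOn_maps
    (fun i => (i.2 ^ i.1.factorization i.2, i.1 / i.2 ^ i.1.factorization i.2)) ?_ ?_
    (fun j _ => by positivity) ?_
  · rintro ⟨m, p⟩ hi
    rw [Finset.mem_sigma] at hi
    obtain ⟨hm, hp⟩ := hi
    obtain ⟨hmx, hmA, hmk⟩ := (mem_A1Upto hx).mp hm
    have hpp := Nat.prime_of_mem_primeFactors hp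
    have hpm := Nat.dvd_of_mem_primeFactors hp
    have hm0 : m ≠ 0 := hmA.1.ne'
    have hd1 : p ^ m.factorization p ∣ m := Nat.ordProj_dvd m p
    have hd2 : m / p ^ m.factorization p ∣ m := Nat.ordCompl_dvd m p
    rw [Finset.mem_product, mem_primePowersOne hx, mem_A1Upto hx]
    refine ⟨⟨?_, ?_, A1_of_dvd hmA hd1⟩, ?_, A1_of_dvd hmA hd2, ?_⟩
    · exact le_trans (by exact_mod_cast Nat.le_of_dvd hmA.1 hd1) hmx
    · exact hpp.isPrimePow.pow (hpp.factorization_pos_of_dvd hm0 hpm).ne'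
    · exact le_trans (by exact_mod_cast Nat.le_of_dvd hmA.1 hd2) hmx
    · have : (m / p ^ m.factorization p).primeFactors = m.primeFactors.erase p := by
        rw [← Nat.support_factorization, Nat.factorization_ordCompl, Finsupp.support_erase,
          Nat.support_factorization]
      dsimp only
      rw [this, Finset.card_erase_of_mem hp, hmk, Nat.add_sub_cancel]
  · rintro ⟨m, p⟩ hi ⟨m', p'⟩ hi' heq
    rw [Finset.mem_coe, Finset.mem_sigma] at hi hi'
    obtain ⟨hm, hp⟩ := hi
    obtain ⟨hm', hp'⟩ := hi'
    simp only [Prod.mk.injEq] at heq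
    have e1 : m = m' := by
      rw [← Nat.ordProj_mul_ordCompl_eq_self m p, ← Nat.ordProj_mul_ordCompl_eq_self m' p',
        heq.2, heq.1]
    have hpp := Nat.prime_of_mem_primeFactors hp
    have hpp' := Nat.prime_of_mem_primeFactors hp'
    have h3 : p ∣ p' ^ m'.factorization p' := by
      rw [← heq.1]
      exact dvd_pow_self p (hpp.factorization_pos_of_dvd
        ((mem_A1Upto hx).mp hm).2.1.1.ne' (Nat.dvd_of_mem_primeFactors hp)).ne'
    have e2 : p = p' := (Nat.prime_dvd_prime_iff_eq hpp hpp').mp (hpp.dvd_of_dvd_pow h3)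
    rw [e1, e2]
  · rintro ⟨m, p⟩ -
    dsimp only
    rw [one_div_mul_one_div, ← Nat.cast_mul, Nat.ordProj_mul_ordCompl_eq_self]

lemma sum_A1Upto_le (k : ℕ) {x : ℝ} (hx : 0 ≤ x) :
    ∑ m ∈ A1Upto k x, 1 / (m : ℝ) ≤ (∑ q ∈ primePowersOne x, 1 / (q : ℝ)) ^ k / k.factorial := by
  induction k with
  | zero =>
    have : A1Upto 0 x ⊆ {1} := by
      intro m hm
      obtain ⟨-, hmA, hmk⟩ := (mem_A1Upto hx).mp hm
      rw [Finset.card_eq_zero, Nat.primeFactors_eq_empty] at hmk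
      have := hmA.1
      simp; omega
    calc _ ≤ ∑ m ∈ ({1} : Finset ℕ), 1 / (m : ℝ) :=
          Finset.sum_le_sum_of_subset_of_nonneg this fun _ _ _ => by positivity
      _ = _ := by simp
  | succ k ih =>
    have h := succ_mul_sum_A1Upto_le k hx
    set S := ∑ q ∈ primePowersOne x, 1 / (q : ℝ) with hS
    have hS0 : 0 ≤ S := Finset.sum_nonneg fun _ _ => by positivity
    have h2 := h.trans (mul_le_mul_of_nonneg_left ih hS0)
    have h3 : (0 : ℝ) < k + 1 := by positivity
    rw [Nat.factorial_succ, pow_succ, le_div_iff₀ (by positivity)]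
    push_cast
    rw [mul_div_assoc', le_div_iff₀ (by positivity)] at h2
    linarith

lemma card_primeFactors_of_prime_pow_mul {p j n : ℕ} (hp : p.Prime) (hj : j ≠ 0) (hn : n ≠ 0) :
    (p ^ j * n).primeFactors.card = n.primeFactors.card ∨
      (p ^ j * n).primeFactors.card = n.primeFactors.card + 1 := by
  rw [Nat.primeFactors_mul (pow_ne_zero _ hp.ne_zero) hn, Nat.primeFactors_prime_pow hj hp,
    ← Finset.insert_eq]
  by_cases h : p ∈ n.primeFactors
  · simp [Finset.insert_eq_of_mem h]
  · simp [Finset.card_insert_of_notMem h]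

lemma sum_log_A1Upto_le (k : ℕ) {x : ℝ} (hx : 0 ≤ x) :
    ∑ m ∈ A1Upto (k + 1) x, log m ≤
      (log 4 + 4) * x * (∑ m ∈ A1Upto k x, 1 / (m : ℝ) + ∑ m ∈ A1Upto (k + 1) x, 1 / (m : ℝ)) := by
  have hdis : Disjoint (A1Upto k x) (A1Upto (k + 1) x) := by
    rw [Finset.disjoint_left]
    intro m h1 h2
    have := ((mem_A1Upto hx).mp h1).2.2
    have := ((mem_A1Upto hx).mp h2).2.2
    omega
  rw [← Finset.sum_union hdis]
  have h1 : ∑ m ∈ A1Upto (k + 1) x, log m =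
      ∑ i ∈ (A1Upto (k + 1) x).sigma fun m => m.divisors.filter IsPrimePow,
        ArithmeticFunction.vonMangoldt i.2 := by
    rw [Finset.sum_sigma]
    refine Finset.sum_congr rfl fun m _ => ?_
    rw [← ArithmeticFunction.vonMangoldt_sum, Finset.sum_filter_of_ne]
    intro d _ hd
    exact ArithmeticFunction.vonMangoldt_ne_zero_iff.mp hd
  rw [h1]
  calc _ ≤ ∑ i ∈ (A1Upto k x ∪ A1Upto (k + 1) x).sigma fun m => Finset.Icc 0 ⌊x / m⌋₊,
        ArithmeticFunction.vonMangoldt i.2 := by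
        refine sum_le_sum_of_injOn_maps (fun i => ⟨i.1 / i.2, i.2⟩) ?_ ?_
          (fun j _ => ArithmeticFunction.vonMangoldt_nonneg) fun i _ => le_rfl
        · rintro ⟨m, d⟩ hi
          rw [Finset.mem_sigma, Finset.mem_filter, Nat.mem_divisors] at hi
          obtain ⟨hm, ⟨hdm, hm0⟩, hd⟩ := hi
          obtain ⟨hmx, hmA, hmk⟩ := (mem_A1Upto hx).mp hm
          have hd2 : m / d ∣ m := Nat.div_dvd_of_dvd hdm
          have hA := A1_of_dvd hmA hd2
          have hle : ((m / d : ℕ) : ℝ) ≤ x :=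
            le_trans (by exact_mod_cast Nat.le_of_dvd hmA.1 hd2) hmx
          rw [Finset.mem_sigma, Finset.mem_union, mem_A1Upto hx, mem_A1Upto hx, Finset.mem_Icc]
          dsimp only at *
          refine ⟨?_, Nat.zero_le _, ?_⟩
          · obtain ⟨p, j, hp, hj, rfl⟩ := hd
            have h3 := card_primeFactors_of_prime_pow_mul hp.nat_prime hj.ne' hA.1.ne'
            rw [Nat.mul_div_cancel' hdm, hmk] at h3
            rcases h3 with h3 | h3
            · exact Or.inr ⟨hle, hA, h3.symm⟩
            · exact Or.inl ⟨hle, hA, by omega⟩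
          · have hq0 : (0 : ℝ) < (m / d : ℕ) := by exact_mod_cast hA.1
            rw [Nat.le_floor_iff (by positivity), le_div_iff₀ hq0, ← Nat.cast_mul,
              Nat.mul_div_cancel' hdm]
            exact hmx
        · rintro ⟨m, d⟩ hi ⟨m', d'⟩ hi' heq
          rw [Finset.mem_coe, Finset.mem_sigma, Finset.mem_filter, Nat.mem_divisors] at hi hi'
          obtain ⟨hm, ⟨hdm, hm0⟩, hd⟩ := hi
          obtain ⟨hm', ⟨hdm', hm0'⟩, hd'⟩ := hi'
          simp only [Sigma.mk.injEq, heq_eq_eq] at heq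
          dsimp only at *
          have e1 : m = m' := by
            rw [← Nat.mul_div_cancel' hdm, ← Nat.mul_div_cancel' hdm', heq.1, heq.2]
          rw [e1, heq.2]
    _ ≤ ∑ m ∈ A1Upto k x ∪ A1Upto (k + 1) x, (log 4 + 4) * x * (1 / (m : ℝ)) := by
        rw [Finset.sum_sigma]
        refine Finset.sum_le_sum fun m _ => ?_
        dsimp only
        rw [← Chebyshev.psi_eq_sum_Icc]
        refine (Chebyshev.psi_le_const_mul_self (by positivity)).trans_eq ?_
        ring
    _ = _ := by rw [Finset.mul_sum]

/-- A Hardy-Ramanujan type upper bound for the elements of `A1` with `k + 1` prime divisors. -/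
theorem ncard_A1_mul_log_le (k : ℕ) {y x : ℝ} (hy : 0 < y) (hx : 0 ≤ x) :
    ({n : ℕ | y ≤ (n : ℝ) ∧ (n : ℝ) ≤ x ∧ n ∈ A1 ∧ n.primeFactors.card = k + 1}.ncard : ℝ) *
      log y ≤ (log 4 + 4) * x *
        ((∑ q ∈ primePowersOne x, 1 / (q : ℝ)) ^ k / k.factorial +
          (∑ q ∈ primePowersOne x, 1 / (q : ℝ)) ^ (k + 1) / (k + 1).factorial) := by
  have h1 : {n : ℕ | y ≤ (n : ℝ) ∧ (n : ℝ) ≤ x ∧ n ∈ A1 ∧ n.primeFactors.card = k + 1} =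
      ((A1Upto (k + 1) x).filter fun n : ℕ => y ≤ (n : ℝ) : Finset ℕ) := by
    ext n
    simp only [Set.mem_ofPred_eq, Finset.coe_filter, mem_A1Upto hx]
    tauto
  rw [h1, Set.ncard_coe_finset, ← nsmul_eq_mul, ← Finset.sum_const]
  calc _ ≤ ∑ n ∈ (A1Upto (k + 1) x).filter fun n : ℕ => y ≤ (n : ℝ), log n :=
        Finset.sum_le_sum fun n hn => log_le_log hy (Finset.mem_filter.mp hn).2
    _ ≤ ∑ n ∈ A1Upto (k + 1) x, log n :=
        Finset.sum_le_sum_of_subset_of_nonneg (Finset.filter_subset _ _)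
          fun n _ _ => log_natCast_nonneg n
    _ ≤ (log 4 + 4) * x *
          (∑ m ∈ A1Upto k x, 1 / (m : ℝ) + ∑ m ∈ A1Upto (k + 1) x, 1 / (m : ℝ)) :=
        sum_log_A1Upto_le k hx
    _ ≤ _ := by
      have h4 : 0 ≤ log 4 := log_nonneg (by norm_num)
      gcongr
      exacts [sum_A1Upto_le k hx, sum_A1Upto_le (k + 1) hx]

section ElementarySymmetric

variable {ι : Type*} {w : ι → ℝ}

/-- The elementary symmetric function of degree `k` in the weights `w i`, `i ∈ Q`. -/
noncomputable def elemSymm (Q : Finset ι) (w : ι → ℝ) (k : ℕ) : ℝ :=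
  ∑ T ∈ Q.powersetCard k, ∏ i ∈ T, w i

lemma succ_mul_elemSymm (Q : Finset ι) (w : ι → ℝ) (k : ℕ) :
    (k + 1) * elemSymm Q w (k + 1) =
      ∑ z ∈ (Q.powersetCard (k + 1)).sigma fun T => T, ∏ i ∈ z.1, w i := by
  rw [Finset.sum_sigma, elemSymm, Finset.mul_sum]
  refine Finset.sum_congr rfl fun T hT => ?_
  dsimp only
  rw [Finset.sum_const, (Finset.mem_powersetCard.mp hT).2, nsmul_eq_mul]
  push_cast
  rfl

variable [DecidableEq ι]

lemma succ_mul_elemSymm_le (Q : Finset ι) (hw : ∀ i, 0 ≤ w i) (k : ℕ) :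
    (k + 1) * elemSymm Q w (k + 1) ≤ elemSymm Q w k * ∑ i ∈ Q, w i := by
  rw [succ_mul_elemSymm, elemSymm, Finset.sum_mul_sum, ← Finset.sum_product']
  refine sum_le_sum_of_injOn_maps (fun z => (z.1.erase z.2, z.2)) ?_ ?_
    (fun j _ => mul_nonneg (Finset.prod_nonneg fun i _ => hw i) (hw _)) ?_
  · rintro ⟨T, i⟩ hz
    rw [Finset.mem_sigma, Finset.mem_powersetCard] at hz
    obtain ⟨⟨hT, hTk⟩, hi⟩ := hz
    dsimp only at *
    rw [Finset.mem_product, Finset.mem_powersetCard, Finset.card_erase_of_mem hi, hTk]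
    exact ⟨⟨(Finset.erase_subset _ _).trans hT, rfl⟩, hT hi⟩
  · rintro ⟨T, i⟩ hz ⟨T', i'⟩ hz' h
    rw [Finset.mem_coe, Finset.mem_sigma] at hz hz'
    simp only [Prod.mk.injEq] at h hz hz'
    obtain ⟨h, rfl⟩ := h
    rw [← Finset.insert_erase hz.2, h, Finset.insert_erase hz'.2]
  · rintro ⟨T, i⟩ hz
    rw [Finset.mem_sigma] at hz
    exact (Finset.prod_erase_mul _ _ hz.2).ge

lemma factorial_mul_elemSymm_le (Q : Finset ι) (hw : ∀ i, 0 ≤ w i) (k : ℕ) :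
    k.factorial * elemSymm Q w k ≤ (∑ i ∈ Q, w i) ^ k := by
  induction k with
  | zero => simp [elemSymm]
  | succ k ih =>
    have h := succ_mul_elemSymm_le Q hw k
    have hS : 0 ≤ ∑ i ∈ Q, w i := Finset.sum_nonneg fun i _ => hw i
    have h1 := mul_le_mul_of_nonneg_left h (show (0 : ℝ) ≤ k.factorial by positivity)
    have h2 := mul_le_mul_of_nonneg_right ih hS
    rw [Nat.factorial_succ, pow_succ]
    push_cast
    linarith

lemma elemSymm_succ_mul_le (Q : Finset ι) (hw : ∀ i, 0 ≤ w i) (k : ℕ) :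
    elemSymm Q w (k + 1) * ∑ i ∈ Q, w i ≤
      (k + 2) * elemSymm Q w (k + 2) + elemSymm Q w k * ∑ i ∈ Q, w i ^ 2 := by
  have e : ((k : ℝ) + 2) = ((k + 1 : ℕ) : ℝ) + 1 := by push_cast; ring
  rw [e, succ_mul_elemSymm, elemSymm, elemSymm, Finset.sum_mul_sum, ← Finset.sum_product',
    Finset.sum_mul_sum, ← Finset.sum_product',
    ← Finset.sum_filter_add_sum_filter_not _ fun z : Finset ι × ι => z.2 ∉ z.1]
  refine add_le_add ?_ ?_
  · refine sum_le_sum_of_injOn_maps (fun z => ⟨insert z.2 z.1, z.2⟩) ?_ ?_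
      (fun j _ => Finset.prod_nonneg fun i _ => hw i) ?_
    · rintro ⟨T, i⟩ hz
      rw [Finset.mem_filter, Finset.mem_product, Finset.mem_powersetCard] at hz
      obtain ⟨⟨⟨hT, hTk⟩, hi⟩, hiT⟩ := hz
      rw [Finset.mem_sigma, Finset.mem_powersetCard]
      refine ⟨⟨Finset.insert_subset hi hT, ?_⟩, Finset.mem_insert_self _ _⟩
      rw [Finset.card_insert_of_notMem hiT, hTk]
    · rintro ⟨T, i⟩ hz ⟨T', i'⟩ hz' h
      rw [Finset.mem_coe, Finset.mem_filter] at hz hz'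
      simp only [Sigma.mk.injEq, heq_eq_eq] at h
      obtain ⟨h, rfl⟩ := h
      dsimp only at hz hz'
      rw [← Finset.erase_insert hz.2, h, Finset.erase_insert hz'.2]
    · rintro ⟨T, i⟩ hz
      rw [Finset.mem_filter] at hz
      dsimp only
      rw [Finset.prod_insert hz.2, mul_comm]
  · refine sum_le_sum_of_injOn_maps (fun z => (z.1.erase z.2, z.2)) ?_ ?_
      (fun j _ => mul_nonneg (Finset.prod_nonneg fun i _ => hw i) (sq_nonneg _)) ?_
    · rintro ⟨T, i⟩ hz
      rw [Finset.mem_filter, Finset.mem_product, Finset.mem_powersetCard, not_not] at hz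
      obtain ⟨⟨⟨hT, hTk⟩, -⟩, hi⟩ := hz
      dsimp only at *
      rw [Finset.mem_product, Finset.mem_powersetCard, Finset.card_erase_of_mem hi, hTk]
      exact ⟨⟨(Finset.erase_subset _ _).trans hT, rfl⟩, hT hi⟩
    · rintro ⟨T, i⟩ hz ⟨T', i'⟩ hz' h
      rw [Finset.mem_coe, Finset.mem_filter, not_not] at hz hz'
      simp only [Prod.mk.injEq] at h hz hz'
      obtain ⟨h, rfl⟩ := h
      rw [← Finset.insert_erase hz.2, h, Finset.insert_erase hz'.2]
    · rintro ⟨T, i⟩ hz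
      rw [Finset.mem_filter, not_not] at hz
      dsimp only at *
      rw [sq, ← mul_assoc, Finset.prod_erase_mul _ _ hz.2]

lemma pow_le_factorial_mul_elemSymm_add (Q : Finset ι) (hw : ∀ i, 0 ≤ w i) (k : ℕ) :
    (∑ i ∈ Q, w i) ^ (k + 2) ≤ (k + 2).factorial * elemSymm Q w (k + 2) +
      (k + 2) * (k + 1) / 2 * (∑ i ∈ Q, w i ^ 2) * (∑ i ∈ Q, w i) ^ k := by
  set S := ∑ i ∈ Q, w i with hS
  set W := ∑ i ∈ Q, w i ^ 2 with hW
  have hS0 : 0 ≤ S := Finset.sum_nonneg fun i _ => hw i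
  have hW0 : 0 ≤ W := Finset.sum_nonneg fun i _ => sq_nonneg _
  have step : ∀ k : ℕ, (k + 1).factorial * elemSymm Q w (k + 1) * S ≤
      (k + 2).factorial * elemSymm Q w (k + 2) + (k + 1) * W * S ^ k := by
    intro k
    have h1 := mul_le_mul_of_nonneg_left (elemSymm_succ_mul_le Q hw k)
      (show (0 : ℝ) ≤ (k + 1).factorial by positivity)
    have h2 := mul_le_mul_of_nonneg_left (factorial_mul_elemSymm_le Q hw k)
      (show (0 : ℝ) ≤ (k + 1) * W by positivity)
    have e1 : ((k + 2).factorial : ℝ) = (k + 2) * (k + 1).factorial := by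
      rw [Nat.factorial_succ (k + 1)]; push_cast; ring
    have e2 : ((k + 1).factorial : ℝ) = (k + 1) * k.factorial := by
      rw [Nat.factorial_succ]; push_cast; ring
    rw [e1]
    rw [e2] at h1 ⊢
    linarith
  induction k with
  | zero =>
    have h := step 0
    have e : elemSymm Q w 1 = S := by simp [elemSymm, Finset.powersetCard_one, hS]
    simp only [zero_add, e] at h
    simp only [zero_add, pow_zero, mul_one, CharP.cast_eq_zero] at *
    norm_num at *
    nlinarith
  | succ k ih =>
    have h := step (k + 1)
    have h2 := mul_le_mul_of_nonneg_right ih hS0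
    push_cast at *
    rw [show k + 1 + 2 = k + 2 + 1 by ring, pow_succ S (k + 2)]
    rw [show k + 1 + 2 = k + 2 + 1 by ring, show k + 1 + 1 = k + 2 by ring] at h
    rw [pow_succ S k] at *
    nlinarith

end ElementarySymmetric

lemma sum_prod_inv_large_le (Q : Finset ℕ) (k : ℕ) {Z η : ℝ} (hZ : 0 < Z) (hη : 0 ≤ η) :
    ∑ T ∈ (Q.powersetCard k).filter fun T => ¬((∏ p ∈ T, p : ℕ) : ℝ) ≤ Z, ∏ p ∈ T, 1 / (p : ℝ) ≤
      Z ^ (-η) * elemSymm Q (fun p => (p : ℝ) ^ η * (1 / p)) k := by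
  rw [elemSymm, Finset.mul_sum]
  calc _ ≤ ∑ T ∈ (Q.powersetCard k).filter fun T => ¬((∏ p ∈ T, p : ℕ) : ℝ) ≤ Z,
        Z ^ (-η) * ∏ p ∈ T, ((p : ℝ) ^ η * (1 / p)) := by
        refine Finset.sum_le_sum fun T hT => ?_
        have h := (not_le.mp (Finset.mem_filter.mp hT).2).le
        rw [Nat.cast_prod] at h
        rw [Finset.prod_mul_distrib, finsetProd_rpow _ _ fun p _ => p.cast_nonneg, ← mul_assoc]
        have h2 : 1 ≤ Z ^ (-η) * (∏ p ∈ T, (p : ℝ)) ^ η := by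
          rw [rpow_neg hZ.le, ← div_eq_inv_mul, one_le_div (by positivity)]
          exact rpow_le_rpow hZ.le h hη
        exact le_mul_of_one_le_left (by positivity) h2
    _ ≤ _ := Finset.sum_le_sum_of_subset_of_nonneg (Finset.filter_subset _ _)
        fun T _ _ => by positivity

/-- Products of `k` primes from `Q` and a large prime contribute distinct elements of `A1`. -/
lemma mul_sum_prod_inv_le_ncard {a b δ X Y₀ : ℝ} (ha : 0 < a) (hb : 0 < b) (hδ : 0 < δ)
    (hX : 1 < X)
    (hδY : ∀ Y, Y₀ ≤ Y → δ * Y / log Y ≤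
      ((Finset.Icc ⌈a * Y⌉₊ ⌊b * Y⌋₊).filter (fun p => p.Prime ∧ p % 4 = 1)).card)
    (hXY : Y₀ ≤ √X) {Q : Finset ℕ}
    (hQ : ∀ p ∈ Q, p.Prime ∧ p % 4 = 1 ∧ (p : ℝ) < a * √X) (k : ℕ) :
    δ * X / log X * ∑ T ∈ (Q.powersetCard k).filter fun T => ((∏ p ∈ T, p : ℕ) : ℝ) ≤ √X,
        ∏ p ∈ T, 1 / (p : ℝ) ≤
      ({n : ℕ | a * X ≤ (n : ℝ) ∧ (n : ℝ) ≤ b * X ∧ n ∈ A1 ∧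
        n.primeFactors.card = k + 1}.ncard : ℝ) := by
  have hX0 : 0 < X := by linarith
  set 𝒯 := (Q.powersetCard k).filter fun T => ((∏ p ∈ T, p : ℕ) : ℝ) ≤ √X with h𝒯
  set P : ℝ → Finset ℕ := fun Y =>
    (Finset.Icc ⌈a * Y⌉₊ ⌊b * Y⌋₊).filter (fun p => p.Prime ∧ p % 4 = 1) with hP
  set S := {n : ℕ | a * X ≤ (n : ℝ) ∧ (n : ℝ) ≤ b * X ∧ n ∈ A1 ∧ n.primeFactors.card = k + 1}
    with hS
  have hSfin : S.Finite := by
    refine (Set.finite_Iic ⌊b * X⌋₊).subset fun n hn => ?_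
    exact Nat.le_floor hn.2.1
  have hT : ∀ T ∈ 𝒯, (T ⊆ Q ∧ T.card = k) ∧ ((∏ p ∈ T, p : ℕ) : ℝ) ≤ √X ∧
      (0 : ℝ) < (∏ p ∈ T, p : ℕ) ∧ √X ≤ X / (∏ p ∈ T, p : ℕ) := by
    intro T hT
    rw [h𝒯, Finset.mem_filter, Finset.mem_powersetCard] at hT
    have h0 : (0 : ℝ) < (∏ p ∈ T, p : ℕ) := by
      exact_mod_cast Finset.prod_pos fun p hp => (hQ p (hT.1.1 hp)).1.pos
    refine ⟨hT.1, hT.2, h0, ?_⟩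
    rw [le_div_iff₀ h0]
    calc √X * (∏ p ∈ T, p : ℕ) ≤ √X * √X := by gcongr; exact hT.2
      _ = X := mul_self_sqrt hX0.le
  have hPm : ∀ T ∈ 𝒯, ∀ q ∈ P (X / (∏ p ∈ T, p : ℕ)), q ∉ Q ∧ q.Prime ∧ q % 4 = 1 ∧
      a * X ≤ ((q * ∏ p ∈ T, p : ℕ) : ℝ) ∧ ((q * ∏ p ∈ T, p : ℕ) : ℝ) ≤ b * X := by
    intro T hTm q hq
    obtain ⟨-, -, h0, h1⟩ := hT T hTm
    rw [hP, Finset.mem_filter, Finset.mem_Icc, Nat.ceil_le, Nat.le_floor_iff (by positivity)] at hq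
    obtain ⟨⟨hq1, hq2⟩, hq3, hq4⟩ := hq
    refine ⟨fun h => ?_, hq3, hq4, ?_, ?_⟩
    · have := (hQ q h).2.2
      have := mul_le_mul_of_nonneg_left h1 ha.le
      linarith
    · rwa [Nat.cast_mul, ← div_le_iff₀ h0, ← mul_div_assoc']
    · rwa [Nat.cast_mul, ← le_div_iff₀ h0, ← mul_div_assoc']
  have hpf : ∀ T ∈ 𝒯, ∀ q ∈ P (X / (∏ p ∈ T, p : ℕ)),
      (q * ∏ p ∈ T, p).primeFactors = insert q T := by
    intro T hTm q hq
    have h1 := hPm T hTm q hq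
    have h2 := hT T hTm
    rw [Nat.primeFactors_mul h1.2.1.ne_zero (by exact_mod_cast h2.2.2.1.ne'),
      Nat.Prime.primeFactors h1.2.1,
      Nat.primeFactors_prod fun p hp => (hQ p (h2.1.1 hp)).1, ← Finset.insert_eq]
  have hcard : ∑ T ∈ 𝒯, ((P (X / (∏ p ∈ T, p : ℕ))).card : ℝ) ≤ S.ncard := by
    rw [← Nat.cast_sum, ← Finset.card_sigma, Nat.cast_le, Set.ncard_eq_toFinset_card S hSfin]
    refine Finset.card_le_card_of_injOn (fun z => z.2 * ∏ p ∈ z.1, p) ?_ ?_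
    · rintro ⟨T, q⟩ hz
      rw [Finset.mem_coe, Finset.mem_sigma] at hz
      obtain ⟨hTm, hq⟩ := hz
      have h1 := hPm T hTm q hq
      have h2 := hT T hTm
      rw [Finset.mem_coe, Set.Finite.mem_toFinset]
      refine ⟨h1.2.2.2.1, h1.2.2.2.2, ⟨?_, ?_⟩, ?_⟩
      · exact Nat.mul_pos h1.2.1.pos (by exact_mod_cast h2.2.2.1)
      · intro p hp hpd
        have hmem : p ∈ (q * ∏ p ∈ T, p).primeFactors := by
          rw [Nat.mem_primeFactors]
          exact ⟨hp, hpd, (Nat.mul_pos h1.2.1.pos (by exact_mod_cast h2.2.2.1)).ne'⟩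
        rw [hpf T hTm q hq, Finset.mem_insert] at hmem
        rcases hmem with rfl | hmem
        · exact h1.2.2.1
        · exact (hQ p (h2.1.1 hmem)).2.1
      · dsimp only
        rw [hpf T hTm q hq, Finset.card_insert_of_notMem fun h => h1.1 (h2.1.1 h), h2.1.2]
    · rintro ⟨T, q⟩ hz ⟨T', q'⟩ hz' h
      rw [Finset.mem_coe, Finset.mem_sigma] at hz hz'
      dsimp only at *
      have h1 := hPm T hz.1 q hz.2
      have h1' := hPm T' hz'.1 q' hz'.2
      have h2 := (hT T hz.1).1.1
      have h2' := (hT T' hz'.1).1.1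
      have h3 : insert q T = insert q' T' := by
        rw [← hpf T hz.1 q hz.2, ← hpf T' hz'.1 q' hz'.2, h]
      have e : q = q' := by
        have : q ∈ insert q' T' := h3 ▸ Finset.mem_insert_self q T
        rcases Finset.mem_insert.mp this with h | h
        · exact h
        · exact absurd (h2' h) h1.1
      subst e
      have : T = T' := by
        rw [← Finset.erase_insert fun h => h1.1 (h2 h), h3,
          Finset.erase_insert fun h => h1.1 (h2' h)]
      rw [this]
  refine le_trans ?_ hcard
  rw [Finset.mul_sum]
  refine Finset.sum_le_sum fun T hTm => ?_
  obtain ⟨-, h1, h0, h2⟩ := hT T hTm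
  refine le_trans ?_ (hδY _ (hXY.trans h2))
  have h3 : 1 < √X := by rwa [lt_sqrt zero_le_one, one_pow]
  have h4 : 1 ≤ ((∏ p ∈ T, p : ℕ) : ℝ) := by exact_mod_cast (Nat.cast_pos.mp h0)
  have h5 : 0 < log (X / (∏ p ∈ T, p : ℕ)) := log_pos (by linarith)
  have h6 : log (X / (∏ p ∈ T, p : ℕ)) ≤ log X :=
    log_le_log (by positivity) (div_le_self hX0.le h4)
  calc _ = δ * (X / (∏ p ∈ T, p : ℕ)) / log X := by
        rw [Finset.prod_div_distrib, Finset.prod_const_one, Nat.cast_prod]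
        ring
    _ ≤ _ := by gcongr

lemma three_quarters_mul_pow_le {ι : Type*} [DecidableEq ι] {w : ι → ℝ} (Q : Finset ι)
    (hw : ∀ i, 0 ≤ w i) {M : ℝ} (hW : M ^ 2 * ∑ i ∈ Q, w i ^ 2 ≤ 1 / 2) {k : ℕ}
    (hk : k ≤ M * ∑ i ∈ Q, w i) :
    3 / 4 * (∑ i ∈ Q, w i) ^ k ≤ k.factorial * elemSymm Q w k := by
  have hS : 0 ≤ ∑ i ∈ Q, w i := Finset.sum_nonneg fun i _ => hw i
  rcases k with _ | _ | k
  · simp [elemSymm]; norm_num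
  · have e : elemSymm Q w 1 = ∑ i ∈ Q, w i := by simp [elemSymm, Finset.powersetCard_one]
    simp only [zero_add, e, pow_one, Nat.factorial_one, Nat.cast_one]
    linarith
  · have h := pow_le_factorial_mul_elemSymm_add Q hw k
    have h0 : 0 ≤ ∑ i ∈ Q, w i ^ 2 := Finset.sum_nonneg fun i _ => sq_nonneg _
    set S := ∑ i ∈ Q, w i
    set W := ∑ i ∈ Q, w i ^ 2
    push_cast at hk
    have h1 : ((k : ℝ) + 2) * (k + 1) / 2 * W ≤ 1 / 4 * S ^ 2 := by
      have h2 : ((k : ℝ) + 2) * (k + 1) ≤ (M * S) ^ 2 := by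
        have h3 : ((k : ℝ) + 2) * (k + 1) ≤ (k + 1 + 1) ^ 2 := by nlinarith
        exact h3.trans (pow_le_pow_left₀ (by positivity) hk 2)
      have h4 := mul_le_mul_of_nonneg_right h2 h0
      have h5 := mul_le_mul_of_nonneg_right hW (sq_nonneg S)
      nlinarith
    have h6 := mul_le_mul_of_nonneg_right h1 (show 0 ≤ S ^ k by positivity)
    have e : S ^ (k + 1 + 1) = S ^ 2 * S ^ k := by ring
    rw [show k + 2 = k + 1 + 1 from rfl, e] at h
    rw [e]
    linarith

lemma add_pow_le_exp_mul {S C M : ℝ} (hS : 0 < S) (hC : 0 ≤ C) {k : ℕ} (hk : k ≤ M * S) :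
    (S + C) ^ k ≤ exp (M * C) * S ^ k := by
  have h1 : S + C ≤ S * exp (C / S) := by
    have := mul_le_mul_of_nonneg_left (add_one_le_exp (C / S)) hS.le
    rw [mul_add, mul_div_cancel₀ _ hS.ne'] at this
    linarith
  calc (S + C) ^ k ≤ (S * exp (C / S)) ^ k := pow_le_pow_left₀ (by positivity) h1 k
    _ = S ^ k * exp (k * (C / S)) := by rw [mul_pow, ← exp_nat_mul]
    _ ≤ S ^ k * exp (M * C) := by
        refine mul_le_mul_of_nonneg_left (exp_le_exp.mpr ?_) (by positivity)
        calc k * (C / S) ≤ M * S * (C / S) := by gcongr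
          _ = M * C := by field_simp
    _ = _ := mul_comm _ _

lemma exists_sum_rpow_inv_log_le : ∃ C, 0 ≤ C ∧ ∀ y : ℝ, 3 ≤ y → ∀ Q ⊆ primesOne y,
    ∑ p ∈ Q, (p : ℝ) ^ (1 / log y) * (1 / p) ≤ ∑ p ∈ Q, 1 / (p : ℝ) + C := by
  obtain ⟨C, hC0, hC⟩ := exists_sum_log_div_le
  refine ⟨exp 1 * C, by positivity, fun y hy Q hQ => ?_⟩
  have hlog : 0 < log y := by linarith [one_le_log_of_three_le hy]
  have h1 : ∀ p ∈ Q, (p : ℝ) ^ (1 / log y) * (1 / p) ≤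
      1 / p + exp 1 * (1 / log y) * (log p / p) := by
    intro p hp
    obtain ⟨hpy, hpp, -⟩ := (mem_primesOne (by linarith)).mp (hQ hp)
    have hp0 : (0 : ℝ) < p := by exact_mod_cast hpp.pos
    set t := log p / log y with ht
    have ht0 : 0 ≤ t := div_nonneg (log_natCast_nonneg p) hlog.le
    have ht1 : t ≤ 1 := (div_le_one hlog).mpr (log_le_log hp0 hpy)
    have h2 : exp t ≤ 1 + exp 1 * t := by
      have h3 := mul_le_mul_of_nonneg_left (add_one_le_exp (-t)) (exp_pos t).le
      rw [← exp_add, add_neg_cancel, exp_zero] at h3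
      have h4 := mul_le_mul_of_nonneg_right (exp_le_exp.mpr ht1) ht0
      linarith
    have e : (p : ℝ) ^ (1 / log y) = exp t := by
      rw [rpow_def_of_pos hp0, mul_one_div]
    rw [e]
    calc _ ≤ (1 + exp 1 * t) * (1 / p) := by gcongr
      _ = _ := by rw [ht]; ring
  have h5 := Finset.sum_le_sum h1
  rw [Finset.sum_add_distrib, ← Finset.mul_sum] at h5
  have h6 : ∑ p ∈ Q, log p / (p : ℝ) ≤ C * log y :=
    (Finset.sum_le_sum_of_subset_of_nonneg hQ fun p _ _ =>
      div_nonneg (log_natCast_nonneg p) p.cast_nonneg).trans (hC y hy)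
  have h7 := mul_le_mul_of_nonneg_left h6 (show 0 ≤ exp 1 * (1 / log y) by positivity)
  have h8 : exp 1 * (1 / log y) * (C * log y) = exp 1 * C := by field_simp
  linarith

/-- A Hardy-Ramanujan type lower bound for the elements of `A1` with `k + 1` prime divisors. -/
theorem exists_le_ncard_A1 {a b M : ℝ} (ha : 0 < a) (hab : a < b) (hM : 0 < M) :
    ∃ δ > 0, ∃ C, ∀ᶠ X in Filter.atTop, ∃ S > 0, |S - 1 / 2 * log (log X)| ≤ C ∧
      ∀ k : ℕ, k ≤ M * S → δ * X / log X * (S ^ k / k.factorial) ≤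
        ({n : ℕ | a * X ≤ (n : ℝ) ∧ (n : ℝ) ≤ b * X ∧ n ∈ A1 ∧
          n.primeFactors.card = k + 1}.ncard : ℝ) := by
  obtain ⟨δ, hδ, hδY⟩ := exists_le_card_primes ha hab
  obtain ⟨Y₀, hY₀⟩ := Filter.eventually_atTop.mp hδY
  obtain ⟨C₁, hC₁0, hC₁⟩ := exists_abs_sum_primesOne_sub_le
  obtain ⟨C₂, hC₂0, hC₂⟩ := exists_sum_rpow_inv_log_le
  have hsq : Summable fun n : ℕ => (1 / (n : ℝ)) ^ 2 := by
    simp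
  obtain ⟨s, hs⟩ := summable_iff_vanishing_norm.mp hsq (1 / (2 * M ^ 2)) (by positivity)
  set ε := 1 / (2 * (M * C₂ + 3)) with hε
  have hε0 : 0 < ε := by positivity
  have hε4 : ε ≤ 1 / 4 := by
    rw [hε]
    apply one_div_le_one_div_of_le (by norm_num)
    nlinarith [mul_nonneg hM.le hC₂0]
  set C := C₁ + 1 / 2 * |log ε| + ∑ n ∈ s, 1 / (n : ℝ) with hC
  refine ⟨δ / 2, by positivity, C, ?_⟩
  have ev1 : ∀ᶠ X in Filter.atTop, 2 * C + 1 ≤ log (log X) :=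
    (tendsto_log_atTop.comp tendsto_log_atTop).eventually_ge_atTop _
  have ev2 : ∀ᶠ X in Filter.atTop, max (log 3 / ε) (max 1 (-8 * log a)) ≤ log X :=
    tendsto_log_atTop.eventually_ge_atTop _
  have ev3 : ∀ᶠ X in Filter.atTop, Y₀ ≤ √X := tendsto_sqrt_atTop.eventually_ge_atTop _
  filter_upwards [ev1, ev2, ev3, Filter.eventually_gt_atTop 1] with X hX1 hX2 hX3 hX4
  have hX0 : 0 < X := by linarith
  have hlX : 1 ≤ log X := ((le_max_left _ _).trans (le_max_right _ _)).trans hX2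
  have hlX0 : 0 < log X := by linarith
  have hla : -8 * log a ≤ log X := ((le_max_right _ _).trans (le_max_right _ _)).trans hX2
  have hl3 : log 3 ≤ ε * log X := by
    have := (le_max_left _ _).trans hX2
    rwa [div_le_iff₀' hε0] at this
  set y := exp (ε * log X) with hy
  have hlogy : log y = ε * log X := log_exp _
  have hy3 : 3 ≤ y := by rwa [hy, ← log_le_iff_le_exp (by norm_num)]
  have hy0 : 0 ≤ y := by linarith
  set Q := primesOne y \ s with hQ
  have hQs : Q ⊆ primesOne y := Finset.sdiff_subset
  set S := ∑ p ∈ Q, 1 / (p : ℝ) with hS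
  have hSb : |S - 1 / 2 * log (log X)| ≤ C := by
    have h1 := abs_le.mp (hC₁ y hy3)
    rw [hlogy, log_mul hε0.ne' hlX0.ne'] at h1
    have h2 : S + ∑ p ∈ primesOne y ∩ s, 1 / (p : ℝ) = ∑ p ∈ primesOne y, 1 / (p : ℝ) := by
      rw [hS, hQ, add_comm]
      exact Finset.sum_inter_add_sum_sdiff _ _ _
    have h3 : ∑ p ∈ primesOne y ∩ s, 1 / (p : ℝ) ≤ ∑ n ∈ s, 1 / (n : ℝ) :=
      Finset.sum_le_sum_of_subset_of_nonneg Finset.inter_subset_right fun _ _ _ => by positivity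
    have h4 : 0 ≤ ∑ p ∈ primesOne y ∩ s, 1 / (p : ℝ) := Finset.sum_nonneg fun _ _ => by positivity
    have h5 := neg_abs_le (log ε)
    have h6 := le_abs_self (log ε)
    rw [abs_le, hC]
    constructor <;> linarith
  have hS0 : 0 < S := by linarith [(abs_le.mp hSb).1]
  refine ⟨S, hS0, hSb, fun k hk => ?_⟩
  have hmain := mul_sum_prod_inv_le_ncard ha (ha.trans hab) hδ hX4 hY₀ hX3 (Q := Q) (fun p hp => by
    obtain ⟨hpy, hpp, hp1⟩ := (mem_primesOne hy0).mp (hQs hp)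
    refine ⟨hpp, hp1, hpy.trans_lt ?_⟩
    rw [hy, ← lt_log_iff_exp_lt (by positivity), log_mul ha.ne' (by positivity),
      log_sqrt hX0.le]
    nlinarith) k
  refine le_trans ?_ hmain
  have hsplit := Finset.sum_filter_add_sum_filter_not (Q.powersetCard k)
    (fun T => ((∏ p ∈ T, p : ℕ) : ℝ) ≤ √X) fun T => ∏ p ∈ T, 1 / (p : ℝ)
  have htail := sum_prod_inv_large_le Q k (sqrt_pos.mpr hX0)
    (show 0 ≤ 1 / log y by rw [hlogy]; positivity)
  have hWs : ∑ p ∈ Q, (1 / (p : ℝ)) ^ 2 < 1 / (2 * M ^ 2) :=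
    (le_abs_self _).trans_lt (hs Q Finset.sdiff_disjoint)
  have hlow := three_quarters_mul_pow_le Q (w := fun p : ℕ => 1 / (p : ℝ))
    (fun p => by positivity) (by
      rw [lt_div_iff₀ (by positivity)] at hWs
      linarith) hk
  have hup := factorial_mul_elemSymm_le Q (w := fun p : ℕ => (p : ℝ) ^ (1 / log y) * (1 / p))
    (fun p => by positivity) k
  have hup2 : (∑ p ∈ Q, (p : ℝ) ^ (1 / log y) * (1 / p)) ^ k ≤ exp (M * C₂) * S ^ k :=
    (pow_le_pow_left₀ (Finset.sum_nonneg fun _ _ => by positivity) (hC₂ y hy3 Q hQs) k).trans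
      (add_pow_le_exp_mul hS0 hC₂0 hk)
  have hZ : √X ^ (-(1 / log y)) = exp (-(M * C₂ + 3)) := by
    rw [rpow_def_of_pos (sqrt_pos.mpr hX0), log_sqrt hX0.le, hlogy, hε]
    congr 1
    field_simp
  rw [hZ] at htail
  have hk0 : (0 : ℝ) < k.factorial := by positivity
  have hfin : exp (-(M * C₂ + 3)) * exp (M * C₂) ≤ 1 / 4 := by
    rw [← exp_add, show -(M * C₂ + 3) + M * C₂ = -3 by ring, exp_neg, ← one_div]
    exact one_div_le_one_div_of_le (by norm_num) (by linarith [add_one_le_exp (3 : ℝ)])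
  have h1 : 1 / 2 * (S ^ k / k.factorial) ≤
      ∑ T ∈ (Q.powersetCard k).filter fun T => ((∏ p ∈ T, p : ℕ) : ℝ) ≤ √X,
        ∏ p ∈ T, 1 / (p : ℝ) := by
    rw [mul_div_assoc', div_le_iff₀' hk0]
    have h2 := mul_le_mul_of_nonneg_left htail hk0.le
    have h3 := mul_le_mul_of_nonneg_left (hup.trans hup2) (exp_pos (-(M * C₂ + 3))).le
    have h4 := mul_le_mul_of_nonneg_right hfin (show 0 ≤ S ^ k by positivity)
    rw [elemSymm] at hlow
    rw [← hsplit] at hlow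
    rw [mul_add] at hlow
    linarith
  calc _ = δ * X / log X * (1 / 2 * (S ^ k / k.factorial)) := by ring
    _ ≤ _ := by gcongr

lemma factorial_le_stirling {n : ℕ} (hn : n ≠ 0) :
    (n.factorial : ℝ) ≤ exp 1 * (√n * (n / exp 1) ^ n) := by
  obtain ⟨m, rfl⟩ := Nat.exists_eq_succ_of_ne_zero hn
  have h := Stirling.stirlingSeq'_antitone (Nat.zero_le m)
  simp only [Function.comp_apply, Nat.succ_eq_add_one, zero_add, Stirling.stirlingSeq_one] at h
  have hpos : (0 : ℝ) < √(2 * (m + 1 : ℕ)) * ((m + 1 : ℕ) / exp 1) ^ (m + 1) := by positivity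
  rw [Stirling.stirlingSeq, div_le_iff₀ hpos, sqrt_mul zero_le_two] at h
  refine h.trans_eq ?_
  have : √(2 : ℝ) ≠ 0 := by positivity
  field_simp

lemma stirling_le_factorial {n : ℕ} : √n * (n / exp 1) ^ n ≤ (n.factorial : ℝ) := by
  refine le_trans ?_ (Stirling.le_factorial_stirling n)
  gcongr
  nlinarith [pi_gt_three, (Nat.cast_nonneg n : (0 : ℝ) ≤ n)]

lemma abs_log_le_two_mul {t : ℝ} (ht : |t - 1| ≤ 1 / 2) : |log t| ≤ 2 * |t - 1| := by
  have h := abs_le.mp ht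
  have h0 : 0 < t := by linarith
  have h1 := log_le_sub_one_of_pos h0
  have h2 := one_sub_inv_le_log_of_pos h0
  have h3 : 1 - t⁻¹ = (t - 1) / t := by field_simp
  have h4 : -(2 * |t - 1|) ≤ (t - 1) / t := by
    rw [le_div_iff₀ h0]
    nlinarith [neg_abs_le (t - 1), abs_nonneg (t - 1)]
  rw [abs_le]
  constructor <;> linarith [le_abs_self (t - 1), abs_nonneg (t - 1)]

lemma exists_abs_mul_one_add_log_sub_le {β C : ℝ} (hβ : 0 < β) (hC : 0 ≤ C) :
    ∃ D, ∀ᶠ L in Filter.atTop, ∀ S : ℝ, |S - L / 2| ≤ C → ∀ k : ℝ, |k - β * L| ≤ 2 →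
      |k * (1 + log S - log k) - (β - β * log (2 * β)) * L| ≤ D := by
  refine ⟨2 * |1 - log (2 * β)| + 2 * β * (4 * C) + 8, ?_⟩
  filter_upwards [Filter.eventually_gt_atTop 0, Filter.eventually_ge_atTop (4 * C),
    Filter.eventually_ge_atTop (4 / β)] with L hL hLC hLβ S hS k hk
  have hβL : 0 < β * L := by positivity
  rw [div_le_iff₀' hβ] at hLβ
  have hk' := abs_le.mp hk
  have hk0 : 0 < k := by linarith
  have hk2 : k ≤ 2 * β * L := by linarith
  have hS' := abs_le.mp hS
  have hSp : 0 < S := by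
    rcases hC.eq_or_lt with h | h <;> linarith
  have a1 : |S / (L / 2) - 1| ≤ 2 * C / L := by
    rw [div_sub_one (by positivity), abs_div, abs_of_pos (show 0 < L / 2 by positivity),
      div_le_div_iff₀ (by positivity) hL]
    nlinarith
  have a2 : |k / (β * L) - 1| ≤ 2 / (β * L) := by
    rw [div_sub_one hβL.ne', abs_div, abs_of_pos hβL]
    gcongr
  have b1 := abs_log_le_two_mul (a1.trans (by rw [div_le_iff₀ hL]; linarith))
  have b2 := abs_log_le_two_mul (a2.trans (by rw [div_le_iff₀ hβL]; linarith))
  have c1 : k * |log (S / (L / 2))| ≤ 2 * β * (4 * C) := by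
    calc _ ≤ 2 * β * L * (2 * (2 * C / L)) := by gcongr; linarith
      _ = _ := by field_simp; ring
  have c2 : k * |log (k / (β * L))| ≤ 8 := by
    calc _ ≤ 2 * β * L * (2 * (2 / (β * L))) := by gcongr; linarith
      _ = _ := by field_simp; ring
  have e : k * (1 + log S - log k) - (β - β * log (2 * β)) * L =
      (k - β * L) * (1 - log (2 * β)) + k * log (S / (L / 2)) - k * log (k / (β * L)) := by
    rw [log_div hSp.ne' (by positivity), log_div hk0.ne' hβL.ne', log_div hL.ne' two_ne_zero,
      log_mul hβ.ne' hL.ne', log_mul two_ne_zero hβ.ne']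
    ring
  rw [e]
  calc _ ≤ |(k - β * L) * (1 - log (2 * β))| + |k * log (S / (L / 2))| +
        |k * log (k / (β * L))| := (abs_sub _ _).trans (by gcongr; exact abs_add_le _ _)
    _ ≤ _ := by
      rw [abs_mul, abs_mul, abs_mul, abs_of_pos hk0]
      gcongr

/-- Poisson weights `S ^ k / k!` with `k` close to `2 β S`. -/
lemma exists_pow_div_factorial_bounds {β C : ℝ} (hβ : 0 < β) (hC : 0 ≤ C) :
    ∃ c₁ > 0, ∃ c₂ > 0, ∀ᶠ L in Filter.atTop, ∀ S : ℝ, |S - L / 2| ≤ C →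
      ∀ k : ℕ, |k - β * L| ≤ 2 →
        c₁ * (exp ((β - β * log (2 * β)) * L) / √L) ≤ S ^ k / k.factorial ∧
        S ^ k / k.factorial ≤ c₂ * (exp ((β - β * log (2 * β)) * L) / √L) := by
  obtain ⟨D, hD⟩ := exists_abs_mul_one_add_log_sub_le hβ hC
  refine ⟨exp (-D) / (exp 1 * √(2 * β)), by positivity, exp D / √(β / 2), by positivity, ?_⟩
  filter_upwards [hD, Filter.eventually_gt_atTop 0, Filter.eventually_gt_atTop (2 * C),
    Filter.eventually_ge_atTop (4 / β)] with L hDL hL hLC hLβ S hS k hk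
  have hβL : 0 < β * L := by positivity
  rw [div_le_iff₀' hβ] at hLβ
  have hk' := abs_le.mp hk
  have hk0 : (0 : ℝ) < k := by linarith
  have hk2 : (k : ℝ) ≤ 2 * β * L := by linarith
  have hk3 : β / 2 * L ≤ (k : ℝ) := by linarith
  have hSp : 0 < S := by linarith [(abs_le.mp hS).1]
  have hkn : k ≠ 0 := by rintro rfl; simp at hk0
  set γ := β - β * log (2 * β)
  have hD' := abs_le.mp (hDL S hS k hk)
  have e : S ^ k / (k / exp 1) ^ k = exp (k * (1 + log S - log k)) := by
    rw [← div_pow, exp_nat_mul, exp_sub, exp_add, exp_log hSp, exp_log hk0]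
    congr 1
    field_simp
  have s1 : √(k : ℝ) ≤ √(2 * β) * √L := by
    rw [← sqrt_mul (by positivity)]
    exact sqrt_le_sqrt hk2
  have s2 : √(β / 2) * √L ≤ √(k : ℝ) := by
    rw [← sqrt_mul (by positivity)]
    exact sqrt_le_sqrt hk3
  have hup : exp (k * (1 + log S - log k)) ≤ exp D * exp (γ * L) := by
    rw [← exp_add]
    exact exp_le_exp.mpr (by linarith)
  have hlow : exp (-D) * exp (γ * L) ≤ exp (k * (1 + log S - log k)) := by
    rw [← exp_add]
    exact exp_le_exp.mpr (by linarith)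
  constructor
  · calc _ = exp (-D) * exp (γ * L) / (exp 1 * (√(2 * β) * √L)) := by field_simp
      _ ≤ exp (k * (1 + log S - log k)) / (exp 1 * √k) := by gcongr
      _ = S ^ k / (exp 1 * (√k * (k / exp 1) ^ k)) := by
        rw [← e, div_div]
        congr 1
        ring
      _ ≤ _ := by
        gcongr
        exact factorial_le_stirling hkn
  · calc _ ≤ S ^ k / (√k * (k / exp 1) ^ k) := by
          gcongr
          exact stirling_le_factorial
      _ = exp (k * (1 + log S - log k)) / √k := by
        rw [← e, div_div]
        congr 1
        ring
      _ ≤ exp D * exp (γ * L) / (√(β / 2) * √L) := by gcongr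
      _ = _ := by field_simp

lemma eventually_le_ncard_A1 {a b β : ℝ} (ha : 0 < a) (hab : a < b) (hβ : 0 < β) :
    ∃ C₁ > 0, ∀ᶠ Λ in Filter.atTop,
      C₁ * (Λ ^ 2 / √(log (log Λ))) * (log Λ) ^ (β - 1 - β * log (2 * β)) ≤
        (({ℓ : ℕ | a * Λ ^ 2 ≤ (ℓ : ℝ) ∧ (ℓ : ℝ) ≤ b * Λ ^ 2 ∧ ℓ ∈ A1 ∧
          ℓ.primeFactors.card = ⌊β * log (log Λ)⌋₊}).ncard : ℝ) := by
  obtain ⟨δ, hδ, C, hX⟩ := exists_le_ncard_A1 (M := 3 * β) ha hab (by positivity)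
  obtain ⟨c₁, hc₁, _, _, hL⟩ := exists_pow_div_factorial_bounds (C := |C| + 1) hβ (by positivity)
  have hLL : Filter.Tendsto (fun Λ : ℝ => log (log Λ)) Filter.atTop Filter.atTop :=
    tendsto_log_atTop.comp tendsto_log_atTop
  refine ⟨δ / 2 * c₁, by positivity, ?_⟩
  filter_upwards [(Filter.tendsto_pow_atTop two_ne_zero).eventually hX, hLL.eventually hL,
    hLL.eventually_ge_atTop (1 / β), hLL.eventually_ge_atTop (6 * (|C| + 1)),
    tendsto_log_atTop.eventually_gt_atTop 0] with Λ h1 h2 h3 h4 h5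
  set L := log (log Λ) with hLdef
  have hL0 : 0 < L := lt_of_lt_of_le (by positivity) h3
  obtain ⟨S, hS0, hS, hk⟩ := h1
  have e1 : log (Λ ^ 2) = 2 * log Λ := by rw [log_pow]; norm_num
  rw [e1, log_mul two_ne_zero h5.ne', ← hLdef] at hS
  rw [e1] at hk
  have hS2 : |S - L / 2| ≤ |C| + 1 := by
    have := abs_le.mp hS
    have h7 := le_abs_self C
    have h8 : 0 ≤ log 2 := log_nonneg one_le_two
    have h9 : log 2 ≤ 1 := by linarith [log_two_lt_d9]
    rw [abs_le]
    constructor <;> linarith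
  rw [div_le_iff₀' hβ] at h3
  obtain ⟨k, hkK⟩ : ∃ k, ⌊β * L⌋₊ = k + 1 :=
    Nat.exists_eq_succ_of_ne_zero (Nat.floor_pos.mpr h3).ne'
  have f1 := Nat.floor_le (show 0 ≤ β * L by positivity)
  have f2 := Nat.lt_floor_add_one (β * L)
  rw [hkK] at f1 f2 ⊢
  push_cast at f1 f2
  have hkL : |k - β * L| ≤ 2 := by rw [abs_le]; constructor <;> linarith
  have hkS : (k : ℝ) ≤ 3 * β * S := by
    have h6 : L ≤ 3 * S := by linarith [(abs_le.mp hS2).1]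
    nlinarith
  refine le_trans ?_ (hk k hkS)
  have h6 := (h2 S hS2 k hkL).1
  have e2 : (log Λ) ^ (β - 1 - β * log (2 * β)) = exp ((β - β * log (2 * β)) * L) / log Λ := by
    rw [show β - 1 - β * log (2 * β) = (β - β * log (2 * β)) - 1 by ring, rpow_sub_one h5.ne',
      rpow_def_of_pos h5, mul_comm (log (log Λ))]
  rw [e2]
  calc _ = δ * Λ ^ 2 / (2 * log Λ) * (c₁ * (exp ((β - β * log (2 * β)) * L) / √L)) := by
        field_simp
    _ ≤ _ := by gcongr

lemma eventually_ncard_A1_le {a b β : ℝ} (ha : 0 < a) (hb : 0 < b) (hβ : 0 < β) :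
    ∃ C₂ > 0, ∀ᶠ Λ in Filter.atTop,
        (({ℓ : ℕ | a * Λ ^ 2 ≤ (ℓ : ℝ) ∧ (ℓ : ℝ) ≤ b * Λ ^ 2 ∧ ℓ ∈ A1 ∧
          ℓ.primeFactors.card = ⌊β * log (log Λ)⌋₊}).ncard : ℝ) ≤
      C₂ * (Λ ^ 2 / √(log (log Λ))) * (log Λ) ^ (β - 1 - β * log (2 * β)) := by
  obtain ⟨C, hC⟩ := exists_sum_primePowersOne_le
  obtain ⟨_, _, c₂, hc₂, hL⟩ := exists_pow_div_factorial_bounds (C := |C| + 1) hβ (by positivity)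
  have hLL : Filter.Tendsto (fun Λ : ℝ => log (log Λ)) Filter.atTop Filter.atTop :=
    tendsto_log_atTop.comp tendsto_log_atTop
  have hB : 0 < log 4 + 4 := by linarith [log_nonneg (show (1 : ℝ) ≤ 4 by norm_num)]
  refine ⟨(log 4 + 4) * b * (2 * c₂), by positivity, ?_⟩
  filter_upwards [hLL.eventually hL, hLL.eventually_ge_atTop (1 / β),
    tendsto_log_atTop.eventually_gt_atTop 0, tendsto_log_atTop.eventually_ge_atTop (-log a),
    tendsto_log_atTop.eventually_ge_atTop (log b), Filter.eventually_gt_atTop 0,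
    (Filter.tendsto_pow_atTop two_ne_zero).eventually_ge_atTop (3 / b)] with
    Λ h2 h3 h5 hla hlb hΛ0 hΛb
  set L := log (log Λ) with hLdef
  have hL0 : 0 < L := lt_of_lt_of_le (by positivity) h3
  rw [div_le_iff₀' hb] at hΛb
  rw [div_le_iff₀' hβ] at h3
  obtain ⟨k, hkK⟩ : ∃ k, ⌊β * L⌋₊ = k + 1 :=
    Nat.exists_eq_succ_of_ne_zero (Nat.floor_pos.mpr h3).ne'
  have f1 := Nat.floor_le (show 0 ≤ β * L by positivity)
  have f2 := Nat.lt_floor_add_one (β * L)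
  rw [hkK] at f1 f2 ⊢
  have hkL1 : |((k + 1 : ℕ) : ℝ) - β * L| ≤ 2 := by rw [abs_le]; constructor <;> linarith
  push_cast at f1 f2
  have hkL : |k - β * L| ≤ 2 := by rw [abs_le]; constructor <;> linarith
  have e1 : log (Λ ^ 2) = 2 * log Λ := by rw [log_pow]; norm_num
  have hmain := ncard_A1_mul_log_le k (show 0 < a * Λ ^ 2 by positivity)
    (show 0 ≤ b * Λ ^ 2 by positivity)
  set N := ({n : ℕ | a * Λ ^ 2 ≤ (n : ℝ) ∧ (n : ℝ) ≤ b * Λ ^ 2 ∧ n ∈ A1 ∧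
    n.primeFactors.card = k + 1}.ncard : ℝ) with hN
  have hN0 : 0 ≤ N := Nat.cast_nonneg _
  have hlog : log Λ ≤ log (a * Λ ^ 2) := by
    rw [log_mul ha.ne' (by positivity), e1]
    linarith
  set S := ∑ q ∈ primePowersOne (b * Λ ^ 2), 1 / (q : ℝ) with hS
  have hS0 : 0 ≤ S := Finset.sum_nonneg fun _ _ => by positivity
  have hSle : S ≤ L / 2 + (|C| + 1) := by
    have h6 := hC _ hΛb
    have h7 : log (log (b * Λ ^ 2)) ≤ log 4 + L := by
      rw [hLdef, ← log_mul (by norm_num) h5.ne']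
      refine log_le_log (by linarith [one_le_log_of_three_le hΛb]) ?_
      rw [log_mul hb.ne' (by positivity), e1]
      linarith
    have h8 : log 4 ≤ 2 := by
      rw [show (4 : ℝ) = 2 ^ 2 by norm_num, log_pow]
      push_cast
      linarith [log_two_lt_d9]
    linarith [le_abs_self C]
  have habs : |L / 2 + (|C| + 1) - L / 2| ≤ |C| + 1 := by
    rw [add_sub_cancel_left, abs_of_pos (by positivity)]
  have g1 := (h2 _ habs k hkL).2
  have g2 := (h2 _ habs (k + 1) hkL1).2
  set E := exp ((β - β * log (2 * β)) * L) / √L with hE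
  have e2 : (log Λ) ^ (β - 1 - β * log (2 * β)) = exp ((β - β * log (2 * β)) * L) / log Λ := by
    rw [show β - 1 - β * log (2 * β) = (β - β * log (2 * β)) - 1 by ring, rpow_sub_one h5.ne',
      rpow_def_of_pos h5, mul_comm (log (log Λ))]
  have hfin : N * log Λ ≤ (log 4 + 4) * (b * Λ ^ 2) * (c₂ * E + c₂ * E) := by
    calc N * log Λ ≤ N * log (a * Λ ^ 2) := by gcongr
      _ ≤ _ := hmain
      _ ≤ (log 4 + 4) * (b * Λ ^ 2) * ((L / 2 + (|C| + 1)) ^ k / k.factorial +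
          (L / 2 + (|C| + 1)) ^ (k + 1) / (k + 1).factorial) := by gcongr
      _ ≤ _ := by gcongr
  rw [e2]
  calc N ≤ (log 4 + 4) * (b * Λ ^ 2) * (c₂ * E + c₂ * E) / log Λ := by rwa [le_div_iff₀ h5]
    _ = _ := by rw [hE]; field_simp; ring

theorem stmt_7 (a b β : ℝ) (ha : 0 < a) (hab : a < b) (hβ : 0 < β) :
    ∃ C₁ C₂ Λ₀ : ℝ, 0 < C₁ ∧ 0 < C₂ ∧ 0 < Λ₀ ∧
      ∀ Λ : ℝ, Λ₀ ≤ Λ →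
        C₁ * (Λ ^ 2 / Real.sqrt (Real.log (Real.log Λ))) *
            (Real.log Λ) ^ (β - 1 - β * Real.log (2 * β)) ≤
          (({ℓ : ℕ | a * Λ ^ 2 ≤ (ℓ : ℝ) ∧ (ℓ : ℝ) ≤ b * Λ ^ 2 ∧ ℓ ∈ A1 ∧
              ℓ.primeFactors.card = ⌊β * Real.log (Real.log Λ)⌋₊}).ncard : ℝ) ∧
        (({ℓ : ℕ | a * Λ ^ 2 ≤ (ℓ : ℝ) ∧ (ℓ : ℝ) ≤ b * Λ ^ 2 ∧ ℓ ∈ A1 ∧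
              ℓ.primeFactors.card = ⌊β * Real.log (Real.log Λ)⌋₊}).ncard : ℝ) ≤
          C₂ * (Λ ^ 2 / Real.sqrt (Real.log (Real.log Λ))) *
            (Real.log Λ) ^ (β - 1 - β * Real.log (2 * β)) := by
  obtain ⟨C₁, hC₁, h₁⟩ := eventually_le_ncard_A1 ha hab hβ
  obtain ⟨C₂, hC₂, h₂⟩ := eventually_ncard_A1_le ha (ha.trans hab) hβ
  obtain ⟨Λ₀, hΛ₀⟩ := Filter.eventually_atTop.mp (h₁.and h₂)
  exact ⟨C₁, C₂, max Λ₀ 1, hC₁, hC₂, lt_max_of_lt_right one_pos,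
    fun Λ hΛ => hΛ₀ Λ ((le_max_left _ _).trans hΛ)⟩
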